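/- arXiv:1705.01843 — 8 statements merged into one kernel-verified Lean document; each statement's English description precedes it below -/
import Mathlib

section
/- Let n, m ≥ 1, let A₁,…,A_m and C be n×n complex Hermitian matrices, let b ∈ ℝ^m and α ∈ ℝ, and let ρ be an n×n positive semidefinite matrix with Tr(ρ) = 1; set X = R·ρ for a real R > 0. Let r ≥ 1 and θ ≥ 0, and let ã₁,…,ã_m, c̃ be real numbers with |ã_j − Tr(A_j ρ)| ≤ θ for every j ∈ [m] and |c̃ − Tr(C ρ)| ≤ θ (these traces are real because the matrices are Hermitian and ρ is Hermitian). For ε ≥ 0 define the polytope P_ε(X) = { y ∈ ℝ^m : y ≥ 0, bᵀy ≤ α, Tr((∑_{j=1}^m y_j A_j − C) X) ≥ −ε }, and define P̃ = { y ∈ ℝ^m : y ≥ 0, bᵀy ≤ α, ∑_{j=1}^m y_j ≤ r, ∑_{j=1}^m ã_j y_j ≥ c̃ − (r+1)θ }. Then P_0(X) ∩ { y ∈ ℝ^m : ∑_{j=1}^m y_j ≤ r } ⊆ P̃ ⊆ P_{4Rrθ}(X). -/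
open scoped ComplexOrder

/-- The real part of `Tr((∑ y_j A_j - C) (R ρ))` is affine in `y`. -/
lemma re_trace_sum_smul_sub_mul_smul {ι κ : Type*} [Fintype ι] [Fintype κ]
    (A : ι → Matrix κ κ ℂ) (C ρ : Matrix κ κ ℂ) (R : ℝ) (y : ι → ℝ) :
    ((((∑ j, (y j : ℂ) • A j) - C) * ((R : ℂ) • ρ)).trace).re =
      R * (∑ j, ((A j * ρ).trace).re * y j - ((C * ρ).trace).re) := by
  simp [sub_mul, Finset.sum_mul, Matrix.trace_sum, Matrix.trace_sub, Matrix.trace_smul,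
    mul_comm (y _), mul_sub, Finset.mul_sum]

/-- Perturbing each coefficient of a nonnegative combination by at most `θ` changes it by at most
`r * θ` when the weights sum to at most `r`. -/
lemma abs_sum_mul_sub_sum_mul_le {ι : Type*} [Fintype ι] {u v y : ι → ℝ} {r θ : ℝ} (hθ : 0 ≤ θ)
    (huv : ∀ j, |u j - v j| ≤ θ) (hy : ∀ j, 0 ≤ y j) (hyr : ∑ j, y j ≤ r) :
    |∑ j, u j * y j - ∑ j, v j * y j| ≤ r * θ := by
  rw [← Finset.sum_sub_distrib]
  calc |∑ j, (u j * y j - v j * y j)| ≤ ∑ j, |u j * y j - v j * y j| :=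
        Finset.abs_sum_le_sum_abs _ _
    _ ≤ ∑ j, y j * θ := by
        refine Finset.sum_le_sum fun j _ => ?_
        rw [← sub_mul, abs_mul, abs_of_nonneg (hy j), mul_comm]
        exact mul_le_mul_of_nonneg_left (huv j) (hy j)
    _ = (∑ j, y j) * θ := (Finset.sum_mul ..).symm
    _ ≤ r * θ := mul_le_mul_of_nonneg_right hyr hθ

/-- Lemma 2 (Arora–Kale oracle polytopes): with X = R·ρ,
P₀(X) ∩ {∑ y_j ≤ r} ⊆ P̃(ã, c̃ − (r+1)θ) ⊆ P_{4Rrθ}(X). -/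
theorem stmt_0 (n m : ℕ) (hn : 1 ≤ n) (hm : 1 ≤ m)
    (A : Fin m → Matrix (Fin n) (Fin n) ℂ) (C : Matrix (Fin n) (Fin n) ℂ)
    (hA : ∀ j, (A j).IsHermitian) (hC : C.IsHermitian)
    (b : Fin m → ℝ) (α : ℝ)
    (ρ : Matrix (Fin n) (Fin n) ℂ) (hρ : ρ.PosSemidef) (hρtr : ρ.trace = 1)
    (R : ℝ) (hR : 0 < R) (r θ : ℝ) (hr : 1 ≤ r) (hθ : 0 ≤ θ)
    (ta : Fin m → ℝ) (tc : ℝ)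
    (hta : ∀ j, |ta j - ((A j * ρ).trace).re| ≤ θ)
    (htc : |tc - ((C * ρ).trace).re| ≤ θ) :
    (∀ y : Fin m → ℝ,
      ((∀ j, 0 ≤ y j) ∧ (∑ j, b j * y j) ≤ α ∧
        0 ≤ ((((∑ j, (y j : ℂ) • A j) - C) * ((R : ℂ) • ρ)).trace).re ∧
        (∑ j, y j) ≤ r) →
      ((∀ j, 0 ≤ y j) ∧ (∑ j, b j * y j) ≤ α ∧ (∑ j, y j) ≤ r ∧
        tc - (r + 1) * θ ≤ ∑ j, ta j * y j)) ∧
    (∀ y : Fin m → ℝ,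
      ((∀ j, 0 ≤ y j) ∧ (∑ j, b j * y j) ≤ α ∧ (∑ j, y j) ≤ r ∧
        tc - (r + 1) * θ ≤ ∑ j, ta j * y j) →
      ((∀ j, 0 ≤ y j) ∧ (∑ j, b j * y j) ≤ α ∧
        -(4 * R * r * θ) ≤ ((((∑ j, (y j : ℂ) • A j) - C) * ((R : ℂ) • ρ)).trace).re)) := by
  have hc := abs_le.mp htc
  constructor
  · rintro y ⟨hy, hb, htr, hyr⟩
    refine ⟨hy, hb, hyr, ?_⟩
    have hs := abs_le.mp (abs_sum_mul_sub_sum_mul_le hθ hta hy hyr)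
    rw [re_trace_sum_smul_sub_mul_smul] at htr
    have := nonneg_of_mul_nonneg_right htr hR
    linarith [hs.1, hc.2]
  · rintro y ⟨hy, hb, hyr, hcut⟩
    refine ⟨hy, hb, ?_⟩
    have hs := abs_le.mp (abs_sum_mul_sub_sum_mul_le hθ hta hy hyr)
    have hrθ : θ ≤ r * θ := le_mul_of_one_le_left hθ hr
    rw [re_trace_sum_smul_sub_mul_smul,
      show -(4 * R * r * θ) = R * -(4 * (r * θ)) by ring]
    refine mul_le_mul_of_nonneg_left ?_ hR.le
    linarith [hs.2, hc.1]
end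

section
/- Let m ≥ 1, let b, ã ∈ ℝ^m and α, c′, r ∈ ℝ, and define P̃ = { y ∈ ℝ^m : y ≥ 0, ∑_{j=1}^m y_j ≤ r, bᵀy ≤ α, ∑_{j=1}^m ã_j y_j ≥ c′ }. If y ∈ P̃, then there exists y′ ∈ P̃ having at most 2 nonzero coordinates such that ∑_{j=1}^m y′_j = ∑_{j=1}^m y_j (equivalently, since both vectors are entrywise nonnegative, ‖y′‖₁ = ‖y‖₁). -/
/-- Three or more vectors of the form `(1, b j)` satisfy a nontrivial linear relation. -/
theorem exists_relation_of_two_lt_card {ι : Type*} [Fintype ι] (b : ι → ℝ) (s : Finset ι)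
    (hs : 2 < s.card) :
    ∃ d : ι → ℝ, (∀ j, d j ≠ 0 → j ∈ s) ∧ (∃ j, d j ≠ 0) ∧ ∑ j, d j = 0 ∧
      ∑ j, b j * d j = 0 := by
  classical
  have hdep : ¬ LinearIndepOn ℝ (fun j => ((1 : ℝ), b j)) (s : Set ι) := by
    intro h
    have hle := LinearIndependent.fintype_card_le_finrank (R := ℝ) h
    simp at hle
    omega
  obtain ⟨g, hg, i, hi, hgi⟩ := not_linearIndepOn_finset_iff.1 hdep
  have h1 := congrArg Prod.fst hg
  have h2 := congrArg Prod.snd hg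
  simp only [Prod.fst_sum, Prod.snd_sum, Prod.smul_mk, smul_eq_mul, mul_one, Prod.fst_zero,
    Prod.snd_zero] at h1 h2
  refine ⟨fun j => if j ∈ s then g j else 0, fun j hj => ?_, ⟨i, by simp [hi, hgi]⟩, ?_, ?_⟩
  · by_contra h
    simp [h] at hj
  · simpa using h1
  · simpa [mul_comm] using h2

/-- Ratio test: moving from a nonnegative vector along a direction with a negative entry
reaches the boundary of the orthant. -/
theorem exists_ratio_step {ι : Type*} [Fintype ι] (y d : ι → ℝ) (hy : ∀ j, 0 ≤ y j)
    (hd : ∃ j, d j < 0) :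
    ∃ t : ℝ, 0 ≤ t ∧ (∀ j, 0 ≤ y j + t * d j) ∧ ∃ j, d j < 0 ∧ y j + t * d j = 0 := by
  classical
  obtain ⟨j₀, hj₀⟩ := hd
  obtain ⟨k, hk, hmin⟩ := (Finset.univ.filter fun j => d j < 0).exists_min_image
    (fun j => y j / -d j) ⟨j₀, by simpa using hj₀⟩
  simp only [Finset.mem_filter, Finset.mem_univ, true_and] at hk hmin
  have ht : 0 ≤ y k / -d k := div_nonneg (hy k) (by linarith)
  refine ⟨y k / -d k, ht, fun j => ?_, k, hk, ?_⟩
  · rcases lt_or_ge (d j) 0 with hj | hj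
    · have := (le_div_iff₀ (neg_pos.2 hj)).1 (hmin j hj)
      linarith
    · exact add_nonneg (hy j) (mul_nonneg ht hj)
  · have := hk.ne
    field_simp
    ring

/-- A nonnegative vector with more than two nonzero entries can be replaced by one with fewer
nonzero entries, without changing the sum or the pairing with `b`, and without decreasing the
pairing with `a`. -/
theorem exists_card_support_lt {ι : Type*} [Fintype ι] (a b y : ι → ℝ) (hy : ∀ j, 0 ≤ y j)
    (hcard : 2 < (Finset.univ.filter fun j => y j ≠ 0).card) :
    ∃ z : ι → ℝ, (∀ j, 0 ≤ z j) ∧ ∑ j, z j = ∑ j, y j ∧ ∑ j, b j * z j = ∑ j, b j * y j ∧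
      ∑ j, a j * y j ≤ ∑ j, a j * z j ∧
      (Finset.univ.filter fun j => z j ≠ 0).card <
        (Finset.univ.filter fun j => y j ≠ 0).card := by
  obtain ⟨d, hsupp, hne, hsum, hb, ha⟩ : ∃ d : ι → ℝ, (∀ j, d j ≠ 0 → y j ≠ 0) ∧
      (∃ j, d j ≠ 0) ∧ ∑ j, d j = 0 ∧ ∑ j, b j * d j = 0 ∧ 0 ≤ ∑ j, a j * d j := by
    obtain ⟨d, hsupp, hne, hsum, hb⟩ := exists_relation_of_two_lt_card b _ hcard
    simp only [Finset.mem_filter, Finset.mem_univ, true_and] at hsupp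
    rcases le_total 0 (∑ j, a j * d j) with h | h
    · exact ⟨d, hsupp, hne, hsum, hb, h⟩
    · exact ⟨fun j => -d j, by simpa using hsupp, by simpa using hne, by simpa using hsum,
        by simpa using hb, by simpa using h⟩
  have hneg : ∃ j, d j < 0 := by
    by_contra! h
    obtain ⟨j, hj⟩ := hne
    exact hj ((Finset.sum_eq_zero_iff_of_nonneg fun i _ => h i).1 hsum j (Finset.mem_univ j))
  obtain ⟨t, ht, hnonneg, k, hk, hzero⟩ := exists_ratio_step y d hy hneg
  have hpair (c : ι → ℝ) :
      ∑ j, c j * (y j + t * d j) = ∑ j, c j * y j + t * ∑ j, c j * d j := by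
    rw [Finset.mul_sum, ← Finset.sum_add_distrib]
    exact Finset.sum_congr rfl fun j _ => by ring
  refine ⟨fun j => y j + t * d j, hnonneg, ?_, ?_, ?_, Finset.card_lt_card ?_⟩
  · simpa [hsum] using hpair 1
  · rw [hpair, hb, mul_zero, add_zero]
  · rw [hpair]
    exact le_add_of_nonneg_right (mul_nonneg ht ha)
  · refine Finset.ssubset_iff_subset_ne.2 ⟨fun j hj => ?_, fun heq => ?_⟩
    · simp only [Finset.mem_filter, Finset.mem_univ, true_and] at hj ⊢
      intro hyj
      have hdj : d j = 0 := by
        by_contra h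
        exact hsupp j h hyj
      exact hj (by rw [hyj, hdj, mul_zero, add_zero])
    · have hmem := Finset.ext_iff.1 heq k
      simp only [Finset.mem_filter, Finset.mem_univ, true_and] at hmem
      exact hmem.2 (hsupp k hk.ne) hzero

/-- Sparsification of dual vectors: if y lies in the polytope
P̃ = {y ≥ 0, ∑ y_j ≤ r, bᵀy ≤ α, ãᵀy ≥ c′}, then there is a 2-sparse y′ in P̃
with the same ℓ₁-norm (i.e. the same coordinate sum, both being nonnegative). -/
theorem stmt_3 (m : ℕ) (hm : 1 ≤ m) (b ta : Fin m → ℝ) (α c' r : ℝ)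
    (y : Fin m → ℝ)
    (hy : (∀ j, 0 ≤ y j) ∧ (∑ j, y j) ≤ r ∧ (∑ j, b j * y j) ≤ α ∧
      c' ≤ ∑ j, ta j * y j) :
    ∃ y' : Fin m → ℝ,
      ((∀ j, 0 ≤ y' j) ∧ (∑ j, y' j) ≤ r ∧ (∑ j, b j * y' j) ≤ α ∧
        c' ≤ ∑ j, ta j * y' j) ∧
      (Finset.univ.filter fun j => y' j ≠ 0).card ≤ 2 ∧
      (∑ j, y' j) = ∑ j, y j := by
  induction hn : (Finset.univ.filter fun j => y j ≠ 0).card using Nat.strong_induction_on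
    generalizing y with
  | _ n ih =>
    rcases Nat.lt_or_ge 2 (Finset.univ.filter fun j => y j ≠ 0).card with hlt | hle
    · obtain ⟨h0, hr, hα, hc⟩ := hy
      obtain ⟨z, hz0, hzsum, hzb, hza, hzcard⟩ := exists_card_support_lt ta b y h0 hlt
      obtain ⟨w, hw, hwcard, hwsum⟩ := ih _ (hn ▸ hzcard) z
        ⟨hz0, hzsum.trans_le hr, hzb.trans_le hα, hc.trans hza⟩ rfl
      exact ⟨w, hw, hwcard, hwsum.trans hzsum⟩
    · exact ⟨y, hy, hle, rfl⟩
end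

section
/- Fix integers n ≥ 1 and m ≥ 2 and a real ε ≥ 0. Let T be a finite set and for each p ∈ T let SDP^(p) be given by n×n complex Hermitian matrices C^(p), A^(p)_1, …, A^(p)_m and a vector b^(p) ∈ ℝ^m. Call y ∈ ℝ^m dual-feasible for SDP^(p) if y ≥ 0 and ∑_{j=1}^m y_j A^(p)_j − C^(p) is positive semidefinite; assume the dual optimal value OPT_p := inf{ ⟨b^(p), y⟩ : y dual-feasible for SDP^(p) } is finite, and call a dual-feasible y ε-optimal if ⟨b^(p), y⟩ ≤ OPT_p + ε. Assume: (i) there are a set S, pairwise disjoint subsets f(p) ⊆ S for p ∈ T, and a map g : ℝ^m → S such that g(y) ∈ f(p) for every p ∈ T and every ε-optimal dual-feasible y for SDP^(p); (ii) for all p, q ∈ T there exist a permutation σ of [n] with associated n×n permutation matrix P_σ, and a permutation π of [m], such that A^(q)_j = P_σ^{−1} A^(p)_{π(j)} P_σ for all j ∈ [m], C^(q) = P_σ^{−1} C^(p) P_σ, and b^(q)_j = b^(p)_{π(j)} for all j ∈ [m]. Then for every p ∈ T, every ε-optimal dual-feasible vector y for SDP^(p) has at least log(|T|)/log(m) nonzero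 coordinates. -/
open scoped ComplexOrder

/-- Relabelling the coordinates and the constraints of an SDP relabels its dual slack matrix. -/
theorem slack_comp_perm {ι κ : Type*} [Fintype ι] {A B : ι → Matrix κ κ ℂ} {C D : Matrix κ κ ℂ}
    {σ : Equiv.Perm κ} {π : Equiv.Perm ι} (hB : ∀ j, B j = (A (π j)).submatrix σ σ)
    (hD : D = C.submatrix σ σ) (y : ι → ℝ) :
    (∑ j, (y (π j) : ℂ) • B j) - D = ((∑ j, (y j : ℂ) • A j) - C).submatrix σ σ := by
  rw [← Equiv.sum_comp π fun j => (y j : ℂ) • A j]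
  ext i k
  simp [hB, hD, Matrix.sum_apply]

/-- Permuting the arguments preserves the objective value. -/
theorem objective_comp_perm {ι : Type*} [Fintype ι] {b c : ι → ℝ} {π : Equiv.Perm ι}
    (hc : ∀ j, c j = b (π j)) (y : ι → ℝ) : ∑ j, c j * y (π j) = ∑ j, b j * y j := by
  simp only [hc]
  exact Equiv.sum_comp π fun j => b j * y j

/-- A vector composed with a permutation is determined by the preimages of its support. -/
theorem comp_perm_eq_of_symm_eq_on_support {ι R : Type*} [Zero R] {y : ι → R}
    {π ρ : Equiv.Perm ι} (h : ∀ j, y j ≠ 0 → π.symm j = ρ.symm j) : y ∘ π = y ∘ ρ := by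
  funext i
  by_cases hπ : y (π i) = 0
  · by_cases hρ : y (ρ i) = 0
    · simp [hπ, hρ]
    · have := h _ hρ
      rw [Equiv.symm_apply_apply, Equiv.symm_apply_eq] at this
      simp [this]
  · have := h _ hπ
    rw [Equiv.symm_apply_apply, Equiv.eq_symm_apply] at this
    simp [this]

/-- A family of pairwise distinct rearrangements of `y` has at most `|ι| ^ |supp y|` members. -/
theorem card_le_pow_card_support {ι τ R : Type*} [Fintype ι] [Fintype τ] [Zero R] (y : ι → R)
    [DecidablePred fun j => y j ≠ 0] (π : τ → Equiv.Perm ι) (hπ : Function.Injective fun q => y ∘ π q) :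
    Fintype.card τ ≤ Fintype.card ι ^ (Finset.univ.filter fun j => y j ≠ 0).card := by
  classical
  have hinj : Function.Injective
      fun (q : τ) (j : (Finset.univ.filter fun j => y j ≠ 0)) => (π q).symm j := by
    intro q r hqr
    refine hπ (comp_perm_eq_of_symm_eq_on_support fun j hj => ?_)
    exact congrFun hqr ⟨j, by simpa using hj⟩
  simpa only [Fintype.card_fun, Fintype.card_coe] using Fintype.card_le_of_injective _ hinj

/-- Density of dual solutions for symmetric families of SDPs: if the SDPs in the family
(indexed by a finite set T) are pairwise equal up to permuting the n coordinates and the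
m constraints ((A^(q))_j = P_σ⁻¹ A^(p)_{π(j)} P_σ, i.e. entrywise a `submatrix` by σ),
the dual optima are attained as greatest lower bounds, and any ε-optimal dual-feasible
vector determines (via g) a solution in the pairwise-disjoint solution sets f(p),
then every ε-optimal dual-feasible vector has at least log|T|/log m nonzero entries. -/
theorem stmt_4 (n m : ℕ) (hn : 1 ≤ n) (hm : 2 ≤ m) (ε : ℝ) (hε : 0 ≤ ε)
    (T : Type) [Fintype T]
    (A : T → Fin m → Matrix (Fin n) (Fin n) ℂ) (C : T → Matrix (Fin n) (Fin n) ℂ)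
    (hA : ∀ p j, (A p j).IsHermitian) (hC : ∀ p, (C p).IsHermitian)
    (b : T → Fin m → ℝ)
    (OPT : T → ℝ)
    (hOPT : ∀ p, IsGLB { v : ℝ | ∃ y : Fin m → ℝ, (∀ j, 0 ≤ y j) ∧
        ((∑ j, (y j : ℂ) • A p j) - C p).PosSemidef ∧ v = ∑ j, b p j * y j } (OPT p))
    (S : Type) (f : T → Set S) (g : (Fin m → ℝ) → S)
    (hdisj : ∀ p q : T, p ≠ q → Disjoint (f p) (f q))
    (hg : ∀ (p : T) (y : Fin m → ℝ), (∀ j, 0 ≤ y j) →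
      ((∑ j, (y j : ℂ) • A p j) - C p).PosSemidef →
      (∑ j, b p j * y j) ≤ OPT p + ε → g y ∈ f p)
    (hsym : ∀ p q : T, ∃ (σ : Equiv.Perm (Fin n)) (π : Equiv.Perm (Fin m)),
      (∀ j, A q j = (A p (π j)).submatrix σ σ) ∧
      C q = (C p).submatrix σ σ ∧
      (∀ j, b q j = b p (π j))) :
    ∀ (p : T) (y : Fin m → ℝ), (∀ j, 0 ≤ y j) →
      ((∑ j, (y j : ℂ) • A p j) - C p).PosSemidef →
      (∑ j, b p j * y j) ≤ OPT p + ε →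
      Real.log (Fintype.card T) / Real.log m ≤
        ((Finset.univ.filter fun j => y j ≠ 0).card : ℝ) := by
  intro p y hy hpsd hval
  have hle : ∀ q, OPT p ≤ OPT q := by
    intro q
    refine (hOPT q).2 ?_
    rintro v ⟨z, hz, hzpsd, rfl⟩
    obtain ⟨σ, π, hAσ, hCσ, hbπ⟩ := hsym q p
    refine (hOPT p).1 ⟨z ∘ π, fun j => hz _, ?_, (objective_comp_perm hbπ z).symm⟩
    simp only [Function.comp_apply]
    rw [slack_comp_perm hAσ hCσ]
    exact hzpsd.submatrix σ
  choose σ π hAσ hCσ hbπ using hsym p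
  have hmem : ∀ q, g (y ∘ π q) ∈ f q := by
    intro q
    refine hg q _ (fun j => hy _) ?_ ?_
    · simp only [Function.comp_apply]
      rw [slack_comp_perm (hAσ q) (hCσ q)]
      exact hpsd.submatrix (σ q)
    · exact (objective_comp_perm (hbπ q) y).le.trans (hval.trans (by linarith [hle q]))
  have hinj : Function.Injective fun q => y ∘ π q := by
    intro q r hqr
    by_contra hne
    have hr := hmem r
    rw [← show y ∘ π q = y ∘ π r from hqr] at hr
    exact Set.disjoint_left.1 (hdisj q r hne) (hmem q) hr
  have hcard := card_le_pow_card_support y π hinj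
  rw [Fintype.card_fin] at hcard
  have hT : 0 < Fintype.card T := Fintype.card_pos_iff.2 ⟨p⟩
  rw [div_le_iff₀ (Real.log_pos (by exact_mod_cast hm)), ← Real.log_pow]
  exact Real.log_le_log (by exact_mod_cast hT) (by exact_mod_cast hcard)
end

section
/- Let k > 0 and R > 0 be reals and let ε ∈ [0, 1/2]. Consider the 3×3 LP data with constraint rows a₁ = (1,1,1), a₂ = (1/k, 1, 0), a₃ = (−1, 0, −1) (so A is the matrix with these rows) and objective vector c = (1, 0, 0). Then every y ∈ ℝ³ satisfying y ≥ 0, y₁ − y₃ ≤ 0 and y₁ + y₂/k − y₃ ≥ 1 − ε has y₂ ≥ k/2, and consequently ‖Aᵀy − c‖_∞ ≥ k/2, where (Aᵀy)_i = ∑_{j=1}^3 y_j (a_j)_i and ‖·‖_∞ is the entrywise maximum-absolute-value norm on ℝ³. -/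
open Matrix

/-- Width lower bound for any oracle on the specific 3×3 LP from the paper:
rows a₁ = (1,1,1), a₂ = (1/k,1,0), a₃ = (−1,0,−1), objective c = (1,0,0).
Every y in the polytope has y₂ ≥ k/2, hence ‖Aᵀy − c‖_∞ ≥ k/2. -/
theorem stmt_5 (k R ε : ℝ) (hk : 0 < k) (hR : 0 < R) (hε0 : 0 ≤ ε) (hε : ε ≤ 1 / 2)
    (y : Fin 3 → ℝ) (hy : ∀ i, 0 ≤ y i)
    (h1 : y 0 - y 2 ≤ 0) (h2 : 1 - ε ≤ y 0 + y 1 / k - y 2) :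
    k / 2 ≤ y 1 ∧
      k / 2 ≤ ‖(!![(1 : ℝ), 1, 1; 1 / k, 1, 0; -1, 0, -1])ᵀ *ᵥ y - ![1, 0, 0]‖ := by
  have hy1 : k / 2 ≤ y 1 := by
    have h : 1 / 2 ≤ y 1 / k := by linarith
    rw [le_div_iff₀ hk] at h
    linarith
  refine ⟨hy1, ?_⟩
  refine le_trans ?_ (norm_le_pi_norm _ 1)
  refine le_trans ?_ (Real.le_norm_self _)
  have h0 := hy 0
  simp [Matrix.mulVec, dotProduct, Fin.sum_univ_three]
  linarith
end

section
/- Let a, b, c be positive integers and let Z : [a] × [b] × [c] → {0,1}. Consider the linear program with variables w ∈ ℝ^c and v^(1),…,v^(a) ∈ ℝ^b, feasible region F = { (w, v^(1),…,v^(a)) : w ≥ 0; v^(i) ≥ 0 for all i ∈ [a]; ∑_{j=1}^b v^(i)_j ≤ 1 for all i ∈ [a]; and w_k ≤ ∑_{i=1}^a ∑_{j=1}^b Z_{ijk} · v^(i)_j for all k ∈ [c] }, and objective ∑_{k=1}^c w_k. Then the supremum of the objective over F is attained and equals ∑_{i=1}^a max_{j ∈ [b]} ∑_{ℓ=1}^c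 Z_{ijℓ}. -/
/-- The LP used in the paper's query lower bound: with 0/1 data Z, the LP
max ∑_k w_k subject to w ≥ 0, v^(i) ≥ 0, ∑_j v^(i)_j ≤ 1,
w_k ≤ ∑_{i,j} Z_{ijk} v^(i)_j has its optimum attained and equal to
∑_i max_j ∑_ℓ Z_{ijℓ}. -/
theorem stmt_7 (a b c : ℕ) (ha : 0 < a) (hb : 0 < b) (hc : 0 < c)
    (Z : Fin a → Fin b → Fin c → ℕ) (hZ : ∀ i j k, Z i j k ≤ 1) :
    IsGreatest
      { s : ℝ | ∃ (w : Fin c → ℝ) (v : Fin a → Fin b → ℝ),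
          (∀ k, 0 ≤ w k) ∧ (∀ i j, 0 ≤ v i j) ∧
          (∀ i, (∑ j, v i j) ≤ 1) ∧
          (∀ k, w k ≤ ∑ i, ∑ j, (Z i j k : ℝ) * v i j) ∧
          s = ∑ k, w k }
      ((∑ i, Finset.univ.sup fun j => ∑ ℓ, Z i j ℓ : ℕ) : ℝ) := by
  have : Nonempty (Fin b) := ⟨⟨0, hb⟩⟩
  constructor
  · have hmax : ∀ i, ∃ j, (Finset.univ.sup fun j => ∑ ℓ, Z i j ℓ) = ∑ ℓ, Z i j ℓ := fun i => by
      obtain ⟨j, -, hj⟩ := Finset.exists_mem_eq_sup Finset.univ Finset.univ_nonempty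
        (fun j => ∑ ℓ, Z i j ℓ)
      exact ⟨j, hj⟩
    choose m hm using hmax
    refine ⟨fun k => ∑ i, (Z i (m i) k : ℝ), fun i j => if j = m i then 1 else 0,
      fun k => by positivity, fun i j => by positivity, fun i => by simp,
      fun k => by simp, ?_⟩
    rw [Finset.sum_comm]
    push_cast [hm]
    rfl
  · rintro s ⟨w, v, -, hv, hv1, hwv, rfl⟩
    calc ∑ k, w k ≤ ∑ k, ∑ i, ∑ j, (Z i j k : ℝ) * v i j :=
          Finset.sum_le_sum fun k _ => hwv k
      _ = ∑ i, ∑ j, ((∑ k, Z i j k : ℕ) : ℝ) * v i j := by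
          rw [Finset.sum_comm]
          refine Finset.sum_congr rfl fun i _ => ?_
          rw [Finset.sum_comm]
          simp only [Nat.cast_sum, Finset.sum_mul]
      _ ≤ ∑ i, ((Finset.univ.sup fun j => ∑ ℓ, Z i j ℓ : ℕ) : ℝ) := by
          refine Finset.sum_le_sum fun i _ => ?_
          calc _ ≤ ∑ j, ((Finset.univ.sup fun j => ∑ ℓ, Z i j ℓ : ℕ) : ℝ) * v i j :=
                Finset.sum_le_sum fun j _ => mul_le_mul_of_nonneg_right
                  (Nat.cast_le.mpr (Finset.le_sup (f := fun j => ∑ ℓ, Z i j ℓ)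
                    (Finset.mem_univ j))) (hv i j)
            _ ≤ _ := by
                rw [← Finset.mul_sum]
                exact mul_le_of_le_one_right (Nat.cast_nonneg _) (hv1 i)
      _ = _ := (Nat.cast_sum _ _).symm
end

section
/- Let f(x) = e^{−x²} on ℝ and let f^{(k)} denote its k-th derivative. Then: (1) f^{(1)}(x) = −2x·f(x), and for all integers k ≥ 1 and all x ∈ ℝ, f^{(k+1)}(x) = −2x·f^{(k)}(x) − 2k·f^{(k−1)}(x); (2) for all natural numbers k and all x ∈ ℝ, |f^{(k)}(x)| ≤ (2|x| + 2k)^k · e^{−x²}; and (3) for all x ∈ ℝ, ∑_{k=0}^∞ (|f^{(k)}(x)| / k!) · (1/(8e))^k ≤ 2, where e is Euler's number. -/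
theorem hasDerivAt_exp_neg_sq (x : ℝ) :
    HasDerivAt (fun x : ℝ => Real.exp (-x ^ 2)) (-2 * x * Real.exp (-x ^ 2)) x := by
  have h := ((hasDerivAt_pow 2 x).fun_neg).exp
  convert h using 1
  push_cast
  ring

theorem hasDerivAt_iteratedDeriv_exp_neg_sq (k : ℕ) (x : ℝ) :
    HasDerivAt (iteratedDeriv k (fun x : ℝ => Real.exp (-x ^ 2)))
      (iteratedDeriv (k + 1) (fun x : ℝ => Real.exp (-x ^ 2)) x) x := by
  have hc : ContDiff ℝ (k + 1 : ℕ) (fun x : ℝ => Real.exp (-x ^ 2)) := by fun_prop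
  rw [iteratedDeriv_succ]
  exact (hc.differentiable_iteratedDeriv k (by exact_mod_cast Nat.lt_succ_self k) x).hasDerivAt

theorem iteratedDeriv_one_exp_neg_sq (x : ℝ) :
    iteratedDeriv 1 (fun x : ℝ => Real.exp (-x ^ 2)) x = -2 * x * Real.exp (-x ^ 2) := by
  rw [iteratedDeriv_one]
  exact (hasDerivAt_exp_neg_sq x).deriv

theorem iteratedDeriv_add_two_exp_neg_sq (k : ℕ) (x : ℝ) :
    iteratedDeriv (k + 2) (fun x : ℝ => Real.exp (-x ^ 2)) x =
      -2 * x * iteratedDeriv (k + 1) (fun x : ℝ => Real.exp (-x ^ 2)) x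
        - 2 * (k + 1) * iteratedDeriv k (fun x : ℝ => Real.exp (-x ^ 2)) x := by
  have hlin (x : ℝ) : HasDerivAt (fun y : ℝ => -2 * y) (-2) x := by
    simpa using (hasDerivAt_id x).const_mul (-2 : ℝ)
  induction k generalizing x with
  | zero =>
    have h := (hlin x).fun_mul (hasDerivAt_exp_neg_sq x)
    rw [zero_add, iteratedDeriv_succ, funext iteratedDeriv_one_exp_neg_sq, h.deriv,
      iteratedDeriv_zero]
    push_cast
    ring
  | succ k ih =>
    have h := ((hlin x).fun_mul (hasDerivAt_iteratedDeriv_exp_neg_sq (k + 1) x)).fun_sub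
      ((hasDerivAt_iteratedDeriv_exp_neg_sq k x).const_mul (2 * ((k : ℝ) + 1)))
    rw [show k + 1 + 2 = k + 2 + 1 from rfl, iteratedDeriv_succ, funext ih, h.deriv,
      show k + 1 + 1 = k + 2 from rfl, ih]
    push_cast
    ring

theorem abs_iteratedDeriv_exp_neg_sq_le (k : ℕ) (x : ℝ) :
    |iteratedDeriv k (fun x : ℝ => Real.exp (-x ^ 2)) x|
      ≤ (2 * |x| + 2 * k) ^ k * Real.exp (-x ^ 2) := by
  induction k using Nat.twoStepInduction with
  | zero => simp
  | one =>
    rw [iteratedDeriv_one_exp_neg_sq, abs_mul, abs_mul, Real.abs_exp]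
    gcongr
    norm_num
  | more k ih₀ ih₁ =>
    have hx := abs_nonneg x
    have hk : (0 : ℝ) ≤ k := k.cast_nonneg
    set E := Real.exp (-x ^ 2) with hE
    have hE0 : 0 < E := Real.exp_pos _
    push_cast at ih₀ ih₁ ⊢
    set M := 2 * |x| + 2 * ((k : ℝ) + 2) with hM
    have h₀ : |iteratedDeriv k (fun x : ℝ => Real.exp (-x ^ 2)) x| ≤ M ^ (k + 1) * E := by
      refine ih₀.trans ?_
      gcongr
      calc (2 * |x| + 2 * (k : ℝ)) ^ k ≤ M ^ k := by gcongr; linarith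
        _ ≤ M ^ (k + 1) := pow_le_pow_right₀ (by linarith) (Nat.le_succ k)
    have h₁ : |iteratedDeriv (k + 1) (fun x : ℝ => Real.exp (-x ^ 2)) x| ≤ M ^ (k + 1) * E := by
      refine ih₁.trans ?_
      gcongr
      linarith
    rw [iteratedDeriv_add_two_exp_neg_sq]
    refine (abs_sub _ _).trans ?_
    rw [abs_mul, abs_mul, abs_mul, abs_of_nonneg (by positivity : (0 : ℝ) ≤ 2 * (k + 1))]
    calc _ ≤ 2 * |x| * (M ^ (k + 1) * E) + 2 * ((k : ℝ) + 1) * (M ^ (k + 1) * E) := by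
          gcongr
          norm_num
      _ = (2 * |x| + 2 * ((k : ℝ) + 1)) * (M ^ (k + 1) * E) := by ring
      _ ≤ M * (M ^ (k + 1) * E) := by
          have : 0 ≤ M ^ (k + 1) * E := by positivity
          gcongr
          linarith
      _ = M ^ (k + 2) * E := by ring

theorem exp_abs_sub_sq_le (x : ℝ) : Real.exp (|x| - x ^ 2) ≤ 3 / 2 := by
  have h : Real.exp (1 / 4) ^ 4 ≤ (3 / 2 : ℝ) ^ 4 := by
    rw [← Real.exp_nat_mul]
    norm_num
    linarith [Real.exp_one_lt_d9]
  refine le_trans (Real.exp_le_exp.2 ?_) (le_of_pow_le_pow_left₀ (by norm_num) (by norm_num) h)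
  nlinarith [sq_nonneg (|x| - 1 / 2), sq_abs x]

theorem taylor_term_exp_neg_sq_le (k : ℕ) (x : ℝ) :
    |iteratedDeriv k (fun x : ℝ => Real.exp (-x ^ 2)) x| / k.factorial
      * (1 / (8 * Real.exp 1)) ^ k ≤ 3 / 2 * (1 / 4 : ℝ) ^ k := by
  have hpow : (|x| + k) ^ k / k.factorial ≤ Real.exp (|x| + k) :=
    Real.pow_div_factorial_le_exp _ (by positivity) k
  calc _ ≤ ((2 * |x| + 2 * k) ^ k * Real.exp (-x ^ 2)) / k.factorial
          * (1 / (8 * Real.exp 1)) ^ k := by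
        gcongr
        exact abs_iteratedDeriv_exp_neg_sq_le k x
    _ = (|x| + k) ^ k / k.factorial * (Real.exp (-x ^ 2) * (2 * (1 / (8 * Real.exp 1))) ^ k) := by
        rw [← mul_add, mul_pow, mul_pow]
        ring
    _ ≤ Real.exp (|x| + k) * (Real.exp (-x ^ 2) * (2 * (1 / (8 * Real.exp 1))) ^ k) := by
        gcongr
    _ = Real.exp (|x| - x ^ 2) * (Real.exp 1 * (2 * (1 / (8 * Real.exp 1)))) ^ k := by
        rw [mul_pow (Real.exp 1), ← Real.exp_nat_mul, mul_one, Real.exp_add, sub_eq_add_neg,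
          Real.exp_add]
        ring
    _ = Real.exp (|x| - x ^ 2) * (1 / 4) ^ k := by
        congr 2
        field_simp
        norm_num
    _ ≤ 3 / 2 * (1 / 4) ^ k := by
        gcongr
        exact exp_abs_sub_sq_le x


/-- Derivatives of f(x) = e^{−x²}: the recurrence
f^{(k+1)}(x) = −2x f^{(k)}(x) − 2k f^{(k−1)}(x), the bound
|f^{(k)}(x)| ≤ (2|x|+2k)^k e^{−x²}, and ∑_k (|f^{(k)}(x)|/k!)(1/(8e))^k ≤ 2. -/
theorem stmt_15 :
    (∀ x : ℝ, deriv (fun x : ℝ => Real.exp (-x ^ 2)) x = -2 * x * Real.exp (-x ^ 2)) ∧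
    (∀ k : ℕ, 1 ≤ k → ∀ x : ℝ,
      iteratedDeriv (k + 1) (fun x : ℝ => Real.exp (-x ^ 2)) x =
        -2 * x * iteratedDeriv k (fun x : ℝ => Real.exp (-x ^ 2)) x
          - 2 * k * iteratedDeriv (k - 1) (fun x : ℝ => Real.exp (-x ^ 2)) x) ∧
    (∀ (k : ℕ) (x : ℝ),
      |iteratedDeriv k (fun x : ℝ => Real.exp (-x ^ 2)) x|
        ≤ (2 * |x| + 2 * k) ^ k * Real.exp (-x ^ 2)) ∧
    (∀ x : ℝ,
      Summable (fun k : ℕ =>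
        |iteratedDeriv k (fun x : ℝ => Real.exp (-x ^ 2)) x| / k.factorial
          * (1 / (8 * Real.exp 1)) ^ k) ∧
      ∑' k : ℕ,
        |iteratedDeriv k (fun x : ℝ => Real.exp (-x ^ 2)) x| / k.factorial
          * (1 / (8 * Real.exp 1)) ^ k ≤ 2) := by
  refine ⟨fun x => (hasDerivAt_exp_neg_sq x).deriv, fun k hk x => ?_,
    abs_iteratedDeriv_exp_neg_sq_le, fun x => ?_⟩
  · obtain ⟨k, rfl⟩ := Nat.exists_eq_add_of_le' hk
    simpa using iteratedDeriv_add_two_exp_neg_sq k x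
  · have hg : HasSum (fun k : ℕ => 3 / 2 * (1 / 4 : ℝ) ^ k) 2 := by
      have h := (hasSum_geometric_of_lt_one (by norm_num : (0 : ℝ) ≤ 1 / 4)
        (by norm_num)).mul_left (3 / 2 : ℝ)
      rwa [show (3 / 2 : ℝ) * (1 - 1 / 4)⁻¹ = 2 by norm_num] at h
    have hs := Summable.of_nonneg_of_le (fun k => by positivity)
      (fun k => taylor_term_exp_neg_sq_le k x) hg.summable
    exact ⟨hs, hg.tsum_eq ▸ hs.tsum_le_tsum (fun k => taylor_term_exp_neg_sq_le k x) hg.summable⟩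
end

section
/- Let n ≥ 1, let D be a nonempty finite set with a function f : D → {0,1}, and for each j ∈ [n] let C_j be a nonempty finite set with a function g_j : C_j → {0,1}. For x = (x¹,…,xⁿ) ∈ C₁×…×C_n write x̃ := (g₁(x¹),…,g_n(xⁿ)) ∈ {0,1}ⁿ, and let ℋ = { x ∈ C₁×…×C_n : x̃ ∈ D }. Let Γ_f be a real symmetric matrix with rows and columns indexed by D satisfying Γ_f[u,v] = 0 whenever f(u) = f(v), and for each j let Γ_{g_j} be a real symmetric matrix indexed by C_j satisfying Γ_{g_j}[u,v] = 0 whenever g_j(u) = g_j(v). Define Γ̂_{g_j} := Γ_{g_j} + ‖Γ_{g_j}‖·I, and define the real symmetric matrix Γ_h indexed by ℋ by Γ_h[x,y] := Γ_f[x̃, ỹ] · ∏_{j=1}^n Γ̂_{g_j}[x^j, y^j]. Then ‖Γ_h‖ = ‖Γ_f‖ · ∏_{j=1}^n ‖Γ_{g_j}‖. -/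
/-- The ℓ₂→ℓ₂ operator norm (spectral norm) of a real matrix indexed by a finite type. -/
noncomputable def specNorm {m : Type} [Fintype m] [DecidableEq m] (M : Matrix m m ℝ) : ℝ :=
  ‖Matrix.toEuclideanCLM (𝕜 := ℝ) M‖

open Matrix in
theorem sum_sq_mulVec_le {m : Type} [Fintype m] [DecidableEq m] (M : Matrix m m ℝ) (v : m → ℝ) :
    ∑ i, (M *ᵥ v) i ^ 2 ≤ specNorm M ^ 2 * ∑ i, v i ^ 2 := by
  have h := (Matrix.toEuclideanCLM (𝕜 := ℝ) M).le_opNorm (WithLp.toLp 2 v)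
  have h2 := pow_le_pow_left₀ (norm_nonneg _) h 2
  rw [mul_pow, EuclideanSpace.real_norm_sq_eq, EuclideanSpace.real_norm_sq_eq] at h2
  simpa [specNorm] using h2

open Matrix in
theorem specNorm_le_of_sum_sq_mulVec_le {m : Type} [Fintype m] [DecidableEq m] (M : Matrix m m ℝ)
    {c : ℝ} (hc : 0 ≤ c) (h : ∀ v : m → ℝ, ∑ i, (M *ᵥ v) i ^ 2 ≤ c ^ 2 * ∑ i, v i ^ 2) :
    specNorm M ≤ c := by
  refine ContinuousLinearMap.opNorm_le_bound _ hc fun v => ?_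
  refine le_of_sq_le_sq ?_ (by positivity)
  rw [mul_pow, EuclideanSpace.real_norm_sq_eq, EuclideanSpace.real_norm_sq_eq]
  simpa using h v.ofLp

open Matrix Kronecker in
theorem specNorm_kronecker_one_le {m k : Type} [Fintype m] [DecidableEq m] [Fintype k]
    [DecidableEq k] (M : Matrix m m ℝ) :
    specNorm (M ⊗ₖ (1 : Matrix k k ℝ)) ≤ specNorm M := by
  refine specNorm_le_of_sum_sq_mulVec_le _ (norm_nonneg _) fun v => ?_
  have key : ∀ p : m × k, ((M ⊗ₖ (1 : Matrix k k ℝ)) *ᵥ v) p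
      = (M *ᵥ fun i => v (i, p.2)) p.1 := by
    intro p
    simp [mulVec, dotProduct, Fintype.sum_prod_type, Matrix.one_apply]
  simp_rw [key, Fintype.sum_prod_type_right, Finset.mul_sum (s := (Finset.univ : Finset k))]
  exact Finset.sum_le_sum fun y _ => sum_sq_mulVec_le M fun i => v (i, y)

open Matrix MatrixOrder in
theorem exists_transpose_mul_self_eq_add_specNorm {m : Type} [Fintype m] [DecidableEq m]
    (M : Matrix m m ℝ) (hM : M.IsSymm) :
    ∃ W : Matrix m m ℝ, Wᵀ * W = M + specNorm M • (1 : Matrix m m ℝ) := by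
  have hpsd : (M + specNorm M • (1 : Matrix m m ℝ)).PosSemidef := by
    refine Matrix.PosSemidef.of_dotProduct_mulVec_nonneg ?_ fun v => ?_
    · simp [Matrix.IsHermitian, Matrix.conjTranspose_eq_transpose_of_trivial, hM.eq]
    · have h1 := abs_real_inner_le_norm (WithLp.toLp 2 v)
        (Matrix.toEuclideanCLM (𝕜 := ℝ) M (WithLp.toLp 2 v))
      have h2 := (Matrix.toEuclideanCLM (𝕜 := ℝ) M).le_opNorm (WithLp.toLp 2 v)
      have h3 := EuclideanSpace.real_norm_sq_eq (WithLp.toLp 2 v)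
      have h4 := mul_le_mul_of_nonneg_left h2 (norm_nonneg (WithLp.toLp 2 v))
      have h5 := (abs_le.mp h1).1
      have h6 : v ⬝ᵥ v = ‖WithLp.toLp 2 v‖ ^ 2 := by
        rw [h3]; simp [dotProduct, sq]
      rw [Matrix.inner_toEuclideanCLM] at h5
      simp only [star_trivial, add_mulVec, smul_mulVec, one_mulVec, dotProduct_add,
        dotProduct_smul, smul_eq_mul, h6]
      change _ ≤ _ * (specNorm M * _) at h4
      simp only at h5
      nlinarith
  obtain ⟨W, hW⟩ := CStarAlgebra.nonneg_iff_eq_star_mul_self.mp hpsd.nonneg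
  refine ⟨W, ?_⟩
  rw [hW, Matrix.star_eq_conjTranspose, Matrix.conjTranspose_eq_transpose_of_trivial]

theorem LinearMap.IsSymmetric.exists_eigenvector_norm {E : Type*} [NormedAddCommGroup E]
    [InnerProductSpace ℝ E] [FiniteDimensional ℝ E] (T : E →L[ℝ] E)
    (hT : (T : E →ₗ[ℝ] E).IsSymmetric) (h0 : 0 < ‖T‖) :
    ∃ v : E, v ≠ 0 ∧ (T v = ‖T‖ • v ∨ T v = -(‖T‖ • v)) := by
  have hne : Nontrivial E := by
    by_contra h
    rw [not_nontrivial_iff_subsingleton] at h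
    rw [Subsingleton.elim T 0, norm_zero] at h0
    exact lt_irrefl _ h0
  obtain ⟨v, hv, hmax⟩ := (isCompact_sphere (0 : E) 1).exists_isMaxOn
    (NormedSpace.sphere_nonempty.mpr zero_le_one) (f := fun x => ‖T x‖) (by fun_prop)
  have hv1 : ‖v‖ = 1 := by simpa using hv
  have hTv : ‖T v‖ = ‖T‖ := by
    refine le_antisymm (by simpa [hv1] using T.le_opNorm v) ?_
    refine T.opNorm_le_of_unit_norm (norm_nonneg _) fun x hx => hmax (by simpa using hx)
  have hsq : T (T v) = ‖T‖ ^ 2 • v := by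
    have h1 : inner ℝ (T (T v)) v = ‖T‖ ^ 2 := by
      have := hT (T v) v
      simp only [ContinuousLinearMap.coe_coe] at this
      rw [this, real_inner_self_eq_norm_sq, hTv]
    have h2 : ‖T (T v)‖ ≤ ‖T‖ ^ 2 := by
      have := T.le_opNorm (T v)
      rwa [hTv, ← sq] at this
    have h3 := norm_sub_sq_real (T (T v)) (‖T‖ ^ 2 • v)
    rw [real_inner_smul_right, h1, norm_smul, hv1] at h3
    have h4 : ‖T (T v)‖ ^ 2 ≤ (‖T‖ ^ 2) ^ 2 := pow_le_pow_left₀ (norm_nonneg _) h2 2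
    have h5 : ‖T (T v) - ‖T‖ ^ 2 • v‖ ^ 2 ≤ 0 := by
      rw [h3, Real.norm_of_nonneg (by positivity)]
      nlinarith
    have h6 : ‖T (T v) - ‖T‖ ^ 2 • v‖ = 0 := by
      nlinarith [norm_nonneg (T (T v) - ‖T‖ ^ 2 • v)]
    exact sub_eq_zero.mp (norm_eq_zero.mp h6)
  by_cases hw : T v + ‖T‖ • v = 0
  · exact ⟨v, by rintro rfl; simp at hv1, Or.inr (eq_neg_of_add_eq_zero_left hw)⟩
  · refine ⟨_, hw, Or.inl ?_⟩
    rw [map_add, map_smul, hsq, smul_add, smul_smul, sq, add_comm]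

open Matrix in
theorem exists_balanced_eigenvector {m : Type} [Fintype m] [DecidableEq m] (g : m → Bool)
    (M : Matrix m m ℝ) (hM : M.IsSymm) (h0 : ∀ u v, g u = g v → M u v = 0)
    (hpos : 0 < specNorm M) :
    ∃ (α : m → ℝ) (c : ℝ), 0 < c ∧ M *ᵥ α = specNorm M • α ∧
      ∀ b, ∑ y, (if g y = b then α y ^ 2 else 0) = c := by
  let s : m → ℝ := fun y => if g y then 1 else -1
  have hs1 : ∀ y, s y * s y = 1 := fun y => by by_cases h : g y <;> simp [s, h]
  have hMs : ∀ v : m → ℝ, M *ᵥ (s * v) = -(s * (M *ᵥ v)) := by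
    intro v
    ext x
    simp only [mulVec, dotProduct, Pi.mul_apply, Pi.neg_apply, Finset.mul_sum,
      ← Finset.sum_neg_distrib]
    refine Finset.sum_congr rfl fun y _ => ?_
    by_cases h : g x = g y
    · simp [h0 x y h]
    · cases hx : g x <;> cases hy : g y <;> simp_all [s]
  obtain ⟨α, hα0, hα⟩ : ∃ α : m → ℝ, α ≠ 0 ∧ M *ᵥ α = specNorm M • α := by
    obtain ⟨v, hv0, hv⟩ := LinearMap.IsSymmetric.exists_eigenvector_norm
      (Matrix.toEuclideanCLM (𝕜 := ℝ) M) (by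
        intro x y
        simp only [ContinuousLinearMap.coe_coe]
        rw [real_inner_comm, Matrix.inner_toEuclideanCLM, Matrix.inner_toEuclideanCLM,
          Matrix.dotProduct_mulVec, ← Matrix.mulVec_transpose, hM.eq, dotProduct_comm]) hpos
    have hv0' : v.ofLp ≠ 0 := fun h => hv0 (by ext i; simp [h])
    rcases hv with hv | hv
    · refine ⟨v.ofLp, hv0', ?_⟩
      have := congrArg WithLp.ofLp hv
      simpa [specNorm] using this
    · refine ⟨s * v.ofLp, ?_, ?_⟩
      · intro h
        apply hv0'
        have h2 : s * (s * v.ofLp) = v.ofLp := by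
          ext y
          simp [← mul_assoc, hs1]
        rw [← h2, h, mul_zero]
      · have := congrArg WithLp.ofLp hv
        rw [Matrix.ofLp_toEuclideanCLM] at this
        rw [hMs, this]
        ext y
        simp [specNorm]
  have horth : (s * α) ⬝ᵥ α = 0 := by
    have h1 : (s * α) ⬝ᵥ (M *ᵥ α) = specNorm M * ((s * α) ⬝ᵥ α) := by
      rw [hα, dotProduct_smul, smul_eq_mul]
    have h2 : (s * α) ⬝ᵥ (M *ᵥ α) = -(specNorm M * ((s * α) ⬝ᵥ α)) := by
      rw [Matrix.dotProduct_mulVec, ← Matrix.mulVec_transpose, hM.eq, hMs, hα, mul_smul_comm,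
        neg_dotProduct, smul_dotProduct, smul_eq_mul]
    have h3 : specNorm M * ((s * α) ⬝ᵥ α) = 0 := by linarith
    exact (mul_eq_zero.mp h3).resolve_left hpos.ne'
  have hsum : ∑ y, (if g y = true then α y ^ 2 else 0) + ∑ y, (if g y = false then α y ^ 2 else 0)
      = ∑ y, α y ^ 2 := by
    rw [← Finset.sum_add_distrib]
    exact Finset.sum_congr rfl fun y _ => by cases g y <;> simp
  have hdiff : ∑ y, (if g y = true then α y ^ 2 else 0)
      - ∑ y, (if g y = false then α y ^ 2 else 0) = 0 := by
    rw [← Finset.sum_sub_distrib]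
    refine Eq.trans ?_ horth
    exact Finset.sum_congr rfl fun y _ => by cases h : g y <;> simp [s, h, sq]
  have hα2 : 0 < ∑ y, α y ^ 2 := by
    obtain ⟨y, hy⟩ := Function.ne_iff.mp hα0
    exact Finset.sum_pos' (fun _ _ => sq_nonneg _) ⟨y, Finset.mem_univ _, by
      have : α y ≠ 0 := hy
      positivity⟩
  refine ⟨α, (∑ y, α y ^ 2) / 2, by positivity, hα, fun b => ?_⟩
  cases b <;> linarith

theorem sum_fiber_add_specNorm_mul {m : Type} [Fintype m] [DecidableEq m] (g : m → Bool)
    (M : Matrix m m ℝ) (h0 : ∀ u v, g u = g v → M u v = 0) (α : m → ℝ)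
    (hα : M.mulVec α = specNorm M • α) (x : m) (b : Bool) :
    ∑ y, (if g y = b then (M + specNorm M • (1 : Matrix m m ℝ)) x y * α y else 0)
      = specNorm M * α x := by
  by_cases hb : g x = b
  · rw [Finset.sum_eq_single x]
    · simp [hb, h0 x x rfl]
    · intro y _ hy
      split_ifs with h
      · simp [h0 x y (hb.trans h.symm), Matrix.one_apply_ne hy.symm]
      · rfl
    · simp
  · have h1 := congrFun hα x
    rw [Pi.smul_apply, smul_eq_mul] at h1
    rw [← h1]
    refine Finset.sum_congr rfl fun y _ => ?_
    split_ifs with h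
    · have : x ≠ y := by rintro rfl; exact hb h
      simp [Matrix.one_apply_ne this]
    · have : g x = g y := by
        revert hb h; cases g x <;> cases g y <;> cases b <;> simp
      simp [h0 x y this]

theorem sum_comp_mem_mul_prod {n : ℕ} (D : Finset (Fin n → Bool)) (C : Fin n → Type)
    [∀ j, Fintype (C j)] (g : ∀ j, C j → Bool)
    (a : {u // u ∈ D} → ℝ) (b : ∀ j, C j → ℝ) :
    ∑ x : {x : ∀ j, C j // (fun j => g j (x j)) ∈ D},
        a ⟨fun j => g j (x.1 j), x.2⟩ * ∏ j, b j (x.1 j)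
      = ∑ u : {u // u ∈ D}, a u * ∏ j, ∑ y, (if g j y = u.1 j then b j y else 0) := by
  classical
  let G : (∀ j, C j) → ℝ := fun x =>
    ∑ u : {u // u ∈ D}, a u * if (fun j => g j (x j)) = u.1 then ∏ j, b j (x j) else 0
  have hmem : ∀ x : {x : ∀ j, C j // (fun j => g j (x j)) ∈ D},
      a ⟨fun j => g j (x.1 j), x.2⟩ * ∏ j, b j (x.1 j) = G x.1 := by
    intro x
    simp only [G]
    rw [Finset.sum_eq_single ⟨fun j => g j (x.1 j), x.2⟩]
    · simp
    · intro u _ hu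
      rw [if_neg, mul_zero]
      intro h
      exact hu (Subtype.ext h.symm)
    · simp
  have hnot : ∀ x : ∀ j, C j, (fun j => g j (x j)) ∉ D → G x = 0 := by
    intro x hx
    refine Finset.sum_eq_zero fun u _ => ?_
    rw [if_neg, mul_zero]
    intro h
    exact hx (h ▸ u.2)
  have hG : ∑ x : {x : ∀ j, C j // (fun j => g j (x j)) ∈ D}, G x.1 = ∑ x, G x := by
    rw [← Finset.sum_subtype (Finset.univ.filter fun x : ∀ j, C j => (fun j => g j (x j)) ∈ D)
      (by simp) G]
    exact Finset.sum_subset (Finset.filter_subset _ _) fun x _ hx => hnot x (by simpa using hx)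
  simp_rw [hmem]
  rw [hG, Finset.sum_comm]
  refine Finset.sum_congr rfl fun u _ => ?_
  rw [← Finset.mul_sum, Finset.prod_univ_sum, Fintype.piFinset_univ]
  simp_rw [Fintype.prod_ite_zero, funext_iff]
  congr!

/-- The composed matrix, for arbitrary inner matrices `H j`. -/
def composedMatrix {n : ℕ} {D : Finset (Fin n → Bool)} {C : Fin n → Type} (g : ∀ j, C j → Bool)
    (A : Matrix {u // u ∈ D} {u // u ∈ D} ℝ) (H : ∀ j, Matrix (C j) (C j) ℝ) :
    Matrix {x : ∀ j, C j // (fun j => g j (x j)) ∈ D}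
      {x : ∀ j, C j // (fun j => g j (x j)) ∈ D} ℝ :=
  Matrix.of fun x y =>
    A ⟨fun j => g j (x.1 j), x.2⟩ ⟨fun j => g j (y.1 j), y.2⟩ * ∏ j, H j (x.1 j) (y.1 j)

open Matrix Matrix.Norms.L2Operator Kronecker in
theorem specNorm_composedMatrix_le {n : ℕ} {D : Finset (Fin n → Bool)} {C : Fin n → Type}
    [∀ j, Fintype (C j)] [∀ j, DecidableEq (C j)] (g : ∀ j, C j → Bool)
    (A : Matrix {u // u ∈ D} {u // u ∈ D} ℝ) (H : ∀ j, Matrix (C j) (C j) ℝ) (l : Fin n → ℝ)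
    (hl : ∀ j, 0 ≤ l j) (hH : ∀ j, ∃ W : Matrix (C j) (C j) ℝ, Wᵀ * W = H j)
    (hdiag : ∀ j x y, g j x = g j y → H j x y = if x = y then l j else 0) :
    specNorm (composedMatrix g A H) ≤ specNorm A * ∏ j, l j := by
  choose W hW using hH
  let E : Matrix ({u // u ∈ D} × ∀ j, C j) {x : ∀ j, C j // (fun j => g j (x j)) ∈ D} ℝ :=
    Matrix.of fun p x =>
      if p.1 = ⟨fun j => g j (x.1 j), x.2⟩ then ∏ j, W j (p.2 j) (x.1 j) else 0
  have hprod : ∀ x y : ∀ j, C j, ∑ k : ∀ j, C j, (∏ j, W j (k j) (x j)) * ∏ j, W j (k j) (y j)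
      = ∏ j, H j (x j) (y j) := by
    intro x y
    simp_rw [← hW, Matrix.mul_apply, Matrix.transpose_apply]
    rw [Finset.prod_univ_sum, Fintype.piFinset_univ]
    simp_rw [Finset.prod_mul_distrib]
  have hfac : composedMatrix g A H = Eᵀ * ((A ⊗ₖ (1 : Matrix (∀ j, C j) (∀ j, C j) ℝ)) * E) := by
    ext x y
    simp only [composedMatrix, E, Matrix.mul_apply, Matrix.transpose_apply, Matrix.of_apply,
      Fintype.sum_prod_type, Matrix.kroneckerMap_apply, Matrix.one_apply]
    rw [← hprod, Finset.mul_sum, Finset.sum_comm]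
    refine Finset.sum_congr rfl fun k _ => ?_
    simp
    ring
  have hEE : Eᵀ * E = (∏ j, l j) • (1 : Matrix _ _ ℝ) := by
    ext x y
    simp only [E, Matrix.mul_apply, Matrix.transpose_apply, Matrix.of_apply,
      Fintype.sum_prod_type, Matrix.smul_apply, Matrix.one_apply, smul_eq_mul]
    rw [Finset.sum_comm]
    simp only [ite_mul, zero_mul, Finset.sum_ite_eq', Finset.mem_univ, if_true]
    by_cases hxy : (fun j => g j (x.1 j)) = fun j => g j (y.1 j)
    · have h1 : ∏ j, H j (x.1 j) (y.1 j) = if x = y then ∏ j, l j else 0 := by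
        simp_rw [hdiag _ _ _ (congrFun hxy _), Fintype.prod_ite_zero, Subtype.ext_iff, funext_iff]
        congr!
      simp [hxy, hprod, h1]
    · have hne : x ≠ y := by rintro rfl; exact hxy rfl
      simp [hxy, hne]
  have hEnorm : ‖E‖ * ‖E‖ ≤ ∏ j, l j := by
    rw [← Matrix.l2_opNorm_conjTranspose_mul_self, Matrix.conjTranspose_eq_transpose_of_trivial,
      hEE]
    refine specNorm_le_of_sum_sq_mulVec_le _ (Finset.prod_nonneg fun j _ => hl j) fun v => ?_
    simp [smul_mulVec, mul_pow, Finset.mul_sum]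
  calc specNorm (composedMatrix g A H)
      = ‖Eᵀ * ((A ⊗ₖ (1 : Matrix (∀ j, C j) (∀ j, C j) ℝ)) * E)‖ := by rw [← hfac]; rfl
    _ ≤ ‖E‖ * (specNorm A * ‖E‖) := by
        refine (Matrix.l2_opNorm_mul _ _).trans ?_
        rw [← Matrix.conjTranspose_eq_transpose_of_trivial, Matrix.l2_opNorm_conjTranspose]
        gcongr
        refine (Matrix.l2_opNorm_mul _ _).trans ?_
        gcongr
        exact specNorm_kronecker_one_le A
    _ = specNorm A * (‖E‖ * ‖E‖) := by ring
    _ ≤ specNorm A * ∏ j, l j := mul_le_mul_of_nonneg_left hEnorm (norm_nonneg _)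

open Matrix in
theorem le_specNorm_composedMatrix {n : ℕ} {D : Finset (Fin n → Bool)} {C : Fin n → Type}
    [∀ j, Fintype (C j)] [∀ j, DecidableEq (C j)] (g : ∀ j, C j → Bool)
    (A : Matrix {u // u ∈ D} {u // u ∈ D} ℝ) (H : ∀ j, Matrix (C j) (C j) ℝ) (l : Fin n → ℝ)
    (hl : ∀ j, 0 < l j) (α : ∀ j, C j → ℝ) (c : Fin n → ℝ) (hc : ∀ j, 0 < c j)
    (hα : ∀ j b, ∑ y, (if g j y = b then α j y ^ 2 else 0) = c j)
    (hH : ∀ j x b, ∑ y, (if g j y = b then H j x y * α j y else 0) = l j * α j x) :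
    specNorm A * ∏ j, l j ≤ specNorm (composedMatrix g A H) := by
  have hL : 0 < ∏ j, l j := Finset.prod_pos fun j _ => hl j
  have hcpos : 0 < ∏ j, c j := Finset.prod_pos fun j _ => hc j
  let V : ({u // u ∈ D} → ℝ) → {x : ∀ j, C j // (fun j => g j (x j)) ∈ D} → ℝ :=
    fun u x => u ⟨fun j => g j (x.1 j), x.2⟩ * ∏ j, α j (x.1 j)
  have hV : ∀ u, ∑ x, V u x ^ 2 = (∏ j, c j) * ∑ w, u w ^ 2 := by
    intro u
    simp_rw [V, mul_pow, ← Finset.prod_pow]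
    rw [sum_comp_mem_mul_prod D C g (fun w => u w ^ 2) fun j y => α j y ^ 2]
    simp_rw [hα, Finset.mul_sum, mul_comm]
  have hint : ∀ u, composedMatrix g A H *ᵥ V u = (∏ j, l j) • V (A *ᵥ u) := by
    intro u
    ext x
    simp only [composedMatrix, mulVec, dotProduct, Matrix.of_apply, V, Pi.smul_apply, smul_eq_mul]
    have h := sum_comp_mem_mul_prod D C g
      (fun w => A ⟨fun j => g j (x.1 j), x.2⟩ w * u w) fun j y => H j (x.1 j) y * α j y
    simp_rw [hH] at h
    rw [← Finset.sum_mul] at h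
    simp_rw [Finset.prod_mul_distrib] at h
    calc _ = _ := Finset.sum_congr rfl fun y _ => by ring
      _ = _ := h
      _ = _ := by ring
  rw [← le_div_iff₀ hL]
  refine specNorm_le_of_sum_sq_mulVec_le _ (div_nonneg (norm_nonneg _) hL.le) fun u => ?_
  have h := sum_sq_mulVec_le (composedMatrix g A H) (V u)
  rw [hint, hV] at h
  simp_rw [Pi.smul_apply, smul_eq_mul, mul_pow] at h
  rw [← Finset.mul_sum, hV, mul_left_comm, mul_left_comm (specNorm _ ^ 2)] at h
  have h' := le_of_mul_le_mul_left h hcpos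
  rw [div_pow, div_mul_eq_mul_div, le_div_iff₀ (by positivity), mul_comm]
  exact h'

/-- Norm-multiplicativity for composed adversary matrices: with Γ̂_{g_j} = Γ_{g_j} + ‖Γ_{g_j}‖·I
and Γ_h[x,y] = Γ_f[x̃,ỹ]·∏_j Γ̂_{g_j}[x^j,y^j] on the composed domain
ℋ = {x : x̃ ∈ D}, one has ‖Γ_h‖ = ‖Γ_f‖·∏_j ‖Γ_{g_j}‖. -/
theorem stmt_18 (n : ℕ) (hn : 1 ≤ n)
    (D : Finset (Fin n → Bool)) (hD : D.Nonempty)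
    (f : (Fin n → Bool) → Bool)
    (C : Fin n → Type) [∀ j, Fintype (C j)] [∀ j, DecidableEq (C j)] [∀ j, Nonempty (C j)]
    (g : ∀ j, C j → Bool)
    (Γf : Matrix {u // u ∈ D} {u // u ∈ D} ℝ) (hΓfsymm : Γf.IsSymm)
    (hΓf0 : ∀ u v : {u // u ∈ D}, f u.1 = f v.1 → Γf u v = 0)
    (Γg : ∀ j, Matrix (C j) (C j) ℝ) (hΓgsymm : ∀ j, (Γg j).IsSymm)
    (hΓg0 : ∀ j, ∀ u v : C j, g j u = g j v → Γg j u v = 0) :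
    specNorm
      (Matrix.of fun x y : {x : ∀ j, C j // (fun j => g j (x j)) ∈ D} =>
        Γf ⟨fun j => g j (x.1 j), x.2⟩ ⟨fun j => g j (y.1 j), y.2⟩ *
          ∏ j, (Γg j + specNorm (Γg j) • (1 : Matrix (C j) (C j) ℝ)) (x.1 j) (y.1 j))
      = specNorm Γf * ∏ j, specNorm (Γg j) := by
  have hdiag : ∀ j x y, g j x = g j y →
      (Γg j + specNorm (Γg j) • (1 : Matrix (C j) (C j) ℝ)) x y
        = if x = y then specNorm (Γg j) else 0 := by
    intro j x y h
    simp [hΓg0 j x y h, Matrix.one_apply]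
  refine le_antisymm
    (specNorm_composedMatrix_le g Γf (fun j => Γg j + specNorm (Γg j) • 1)
      (fun j => specNorm (Γg j)) (fun j => norm_nonneg _)
      (fun j => exists_transpose_mul_self_eq_add_specNorm (Γg j) (hΓgsymm j)) hdiag) ?_
  by_cases hpos : ∀ j, 0 < specNorm (Γg j)
  · choose α c hc hα hbal using fun j =>
      exists_balanced_eigenvector (g j) (Γg j) (hΓgsymm j) (hΓg0 j) (hpos j)
    exact le_specNorm_composedMatrix g Γf (fun j => Γg j + specNorm (Γg j) • 1)
      (fun j => specNorm (Γg j)) hpos α c hc hbal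
      fun j => sum_fiber_add_specNorm_mul (g j) (Γg j) (hΓg0 j) (α j) (hα j)
  · obtain ⟨j, hj⟩ := not_forall.mp hpos
    have hj0 : specNorm (Γg j) = 0 := le_antisymm (not_lt.mp hj) (norm_nonneg _)
    rw [Finset.prod_eq_zero (Finset.mem_univ j) hj0, mul_zero]
    exact norm_nonneg _
end

section
/- For a finite nonempty set 𝒟 ⊆ {0,1}^N and a function F : 𝒟 → {0,1}, define the (general) adversary bound Adv(F) as the supremum, over all nonzero real symmetric matrices Γ indexed by 𝒟 that satisfy Γ[x,y] = 0 whenever F(x) = F(y), of the ratio ‖Γ‖ / max_{i ∈ [N]} ‖Γ ∘ Δ_i‖, where Δ_i is the 0/1 matrix with Δ_i[x,y] = 1 exactly when x_i ≠ y_i, and ∘ denotes the entrywise (Hadamard) product; note that for any nonzero feasible Γ the denominator is positive. Now let f : D → {0,1} with D ⊆ {0,1}^n nonempty, and for j ∈ [n] let g_j : C_j → {0,1} with C_j ⊆ {0,1}^{k_j} nonempty; assume f and each g_j are non-constant. Define the composed function h = f ∘ (g₁,…,g_n) on the domain ℋ = { x ∈ {0,1}^{k₁+…+k_n} : x^j ∈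 C_j for all j and x̃ ∈ D } by h(x) = f(x̃), where x^j is the j-th block of x and x̃ = (g₁(x¹),…,g_n(xⁿ)). Then Adv(h) ≥ Adv(f) · min_{j ∈ [n]} Adv(g_j). -/
/-- The general adversary bound of a (partial) Boolean function F with domain the
finite set D of bitstrings indexed by ι: the supremum over nonzero real symmetric
adversary matrices Γ (with Γ[x,y] = 0 whenever F(x) = F(y)) of
‖Γ‖ / max_i ‖Γ ∘ Δ_i‖, where (Γ ∘ Δ_i)[x,y] = Γ[x,y] if x_i ≠ y_i and 0 otherwise. -/
noncomputable def adv {ι : Type} [Fintype ι] [DecidableEq ι]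
    (D : Finset (ι → Bool)) (F : (ι → Bool) → Bool) : ℝ :=
  sSup { r : ℝ | ∃ Γ : Matrix {u // u ∈ D} {u // u ∈ D} ℝ, Γ ≠ 0 ∧ Γ.IsSymm ∧
      (∀ x y : {u // u ∈ D}, F x.1 = F y.1 → Γ x y = 0) ∧
      r = specNorm Γ /
        ⨆ i : ι, specNorm (Matrix.of fun x y : {u // u ∈ D} =>
          if x.1 i = y.1 i then 0 else Γ x y) }

section SpecNorm
variable {m : Type} [Fintype m] [DecidableEq m]

lemma specNorm_nonneg (M : Matrix m m ℝ) : 0 ≤ specNorm M := norm_nonneg _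

/-- A bilinear form of a matrix is controlled by the spectral norm, in additive form. -/
lemma bilin_le_specNorm (M : Matrix m m ℝ) (φ ψ : m → ℝ) :
    ∑ x, ∑ y, φ x * M x y * ψ y ≤ specNorm M * ((∑ x, φ x ^ 2 + ∑ y, ψ y ^ 2) / 2) := by
  have h1 := real_inner_le_norm (WithLp.toLp 2 φ)
    (Matrix.toEuclideanCLM (𝕜 := ℝ) M (WithLp.toLp 2 ψ))
  have h2 := (Matrix.toEuclideanCLM (𝕜 := ℝ) M).le_opNorm (WithLp.toLp 2 ψ)
  have h3 : inner ℝ (WithLp.toLp 2 φ) (Matrix.toEuclideanCLM (𝕜 := ℝ) M (WithLp.toLp 2 ψ))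
      = ∑ x, ∑ y, φ x * M x y * ψ y := by
    simp only [Matrix.toEuclideanCLM_toLp, PiLp.inner_apply, Matrix.mulVec, dotProduct,
      RCLike.inner_apply, conj_trivial, Finset.sum_mul]
    exact Finset.sum_congr rfl fun x _ => Finset.sum_congr rfl fun y _ => by ring
  have h4 := EuclideanSpace.real_norm_sq_eq (WithLp.toLp 2 φ)
  have h5 := EuclideanSpace.real_norm_sq_eq (WithLp.toLp 2 ψ)
  simp only at h4 h5
  rw [h3] at h1
  rw [← h4, ← h5]
  have h6 := mul_le_mul_of_nonneg_left h2 (norm_nonneg (WithLp.toLp 2 φ))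
  change _ ≤ _ * (specNorm M * _) at h6
  nlinarith [mul_nonneg (specNorm_nonneg M)
    (sq_nonneg (‖WithLp.toLp 2 φ‖ - ‖WithLp.toLp 2 ψ‖))]

lemma specNorm_le_of_bilin_le (M : Matrix m m ℝ) {c : ℝ} (hc : 0 ≤ c)
    (h : ∀ φ ψ : m → ℝ,
      ∑ x, ∑ y, φ x * M x y * ψ y ≤ c * ((∑ x, φ x ^ 2 + ∑ y, ψ y ^ 2) / 2)) :
    specNorm M ≤ c := by
  refine ContinuousLinearMap.opNorm_le_bound _ hc fun v => ?_
  set T := Matrix.toEuclideanCLM (𝕜 := ℝ) M with hT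
  have hTv : ∀ x, (T v).ofLp x = ∑ y, M x y * v.ofLp y := fun x => by
    rw [hT, Matrix.ofLp_toEuclideanCLM]; rfl
  have n1 := EuclideanSpace.real_norm_sq_eq (T v)
  have n2 := EuclideanSpace.real_norm_sq_eq v
  rcases (norm_nonneg (T v)).eq_or_lt with h0 | h0
  · rw [← h0]; positivity
  have key := h (fun x => ‖v‖ / ‖T v‖ * (T v).ofLp x) v.ofLp
  have e1 : ∑ x, ∑ y, ‖v‖ / ‖T v‖ * (T v).ofLp x * M x y * v.ofLp y
      = ‖v‖ / ‖T v‖ * ‖T v‖ ^ 2 := by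
    rw [n1, Finset.mul_sum]
    refine Finset.sum_congr rfl fun x _ => ?_
    rw [sq, ← mul_assoc]
    conv_rhs => rw [hTv x, ← hTv x]
    conv_rhs => arg 2; rw [hTv x]
    rw [Finset.mul_sum]
    exact Finset.sum_congr rfl fun y _ => by ring
  have e2 : ∑ x, (‖v‖ / ‖T v‖ * (T v).ofLp x) ^ 2 = ‖v‖ ^ 2 := by
    simp only [mul_pow]
    rw [← Finset.mul_sum, ← n1]
    field_simp
  rw [e1, e2, ← n2] at key
  rcases (norm_nonneg v).eq_or_lt with hv | hv
  · have : v = 0 := norm_eq_zero.1 hv.symm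
    simp [this]
  have e3 : ‖v‖ / ‖T v‖ * ‖T v‖ ^ 2 = ‖v‖ * ‖T v‖ := by field_simp
  rw [e3] at key
  refine le_of_mul_le_mul_left ?_ hv
  linarith

/-- Every entry of a matrix is bounded by the spectral norm. -/
lemma abs_apply_le_specNorm (M : Matrix m m ℝ) (x y : m) : |M x y| ≤ specNorm M := by
  have h1 := bilin_le_specNorm M (Pi.single x 1) (Pi.single y 1)
  have h2 := bilin_le_specNorm M (Pi.single x (-1)) (Pi.single y 1)
  simp [Pi.single_apply, ite_pow] at h1 h2
  rw [abs_le]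
  constructor <;> linarith

lemma specNorm_pos {M : Matrix m m ℝ} (hM : M ≠ 0) : 0 < specNorm M := by
  by_contra! h
  apply hM
  ext x y
  have := (abs_apply_le_specNorm M x y).trans h
  simpa using this

lemma specNorm_le_of_abs_apply_le (M : Matrix m m ℝ) {c : ℝ} (hc : 0 ≤ c)
    (h : ∀ x y, |M x y| ≤ c) : specNorm M ≤ (Fintype.card m : ℝ) * c := by
  refine specNorm_le_of_bilin_le M (by positivity) fun φ ψ => ?_
  calc ∑ x, ∑ y, φ x * M x y * ψ y
      ≤ ∑ x, ∑ y, c * ((φ x ^ 2 + ψ y ^ 2) / 2) := by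
        refine Finset.sum_le_sum fun x _ => Finset.sum_le_sum fun y _ => ?_
        have h1 : |φ x * M x y * ψ y| ≤ c * (|φ x| * |ψ y|) := by
          rw [abs_mul, abs_mul]
          nlinarith [h x y, mul_nonneg (abs_nonneg (φ x)) (abs_nonneg (ψ y))]
        have h2 : |φ x| * |ψ y| ≤ (φ x ^ 2 + ψ y ^ 2) / 2 := by
          nlinarith [sq_nonneg (|φ x| - |ψ y|), sq_abs (φ x), sq_abs (ψ y)]
        exact (le_abs_self _).trans (h1.trans (mul_le_mul_of_nonneg_left h2 hc))
    _ = _ := by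
        simp only [← Finset.mul_sum, ← Finset.sum_div, Finset.sum_add_distrib, Finset.sum_const,
          Finset.card_univ, nsmul_eq_mul]
        ring

/-- The spectral norm is attained on a unit vector. -/
lemma exists_unit_mulVec {M : Matrix m m ℝ} (hM : M ≠ 0) :
    ∃ v : m → ℝ, ∑ x, v x ^ 2 = 1 ∧ ∑ x, (M.mulVec v x) ^ 2 = specNorm M ^ 2 := by
  set T := Matrix.toEuclideanCLM (𝕜 := ℝ) M with hT
  obtain ⟨v, hv, hmax⟩ := (isCompact_closedBall (0 : EuclideanSpace ℝ m) 1).exists_isMaxOn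
    ⟨0, by simp⟩ (f := fun w => ‖T w‖) (by fun_prop)
  have hle : ‖T‖ ≤ ‖T v‖ := by
    refine T.opNorm_le_of_unit_norm (norm_nonneg _) fun x hx => ?_
    exact hmax (by simp [hx])
  have hv1 : ‖v‖ ≤ 1 := by simpa using hv
  have hpos : 0 < ‖T‖ := specNorm_pos hM
  have hop := T.le_opNorm v
  have hn1 : ‖v‖ = 1 := by
    by_contra hne
    have : ‖v‖ < 1 := lt_of_le_of_ne hv1 hne
    nlinarith
  have hn2 : ‖T v‖ = ‖T‖ := by
    rw [hn1] at hop; linarith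
  refine ⟨v.ofLp, ?_, ?_⟩
  · rw [← EuclideanSpace.real_norm_sq_eq, hn1]; norm_num
  · rw [← Matrix.ofLp_toEuclideanCLM, ← EuclideanSpace.real_norm_sq_eq, ← hT, hn2]; rfl

lemma sum_mulVec_sq_le (M : Matrix m m ℝ) (v : m → ℝ) :
    ∑ x, (M.mulVec v x) ^ 2 ≤ specNorm M ^ 2 * ∑ x, v x ^ 2 := by
  have h := (Matrix.toEuclideanCLM (𝕜 := ℝ) M).le_opNorm (WithLp.toLp 2 v)
  have h2 := pow_le_pow_left₀ (norm_nonneg _) h 2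
  rw [mul_pow, EuclideanSpace.real_norm_sq_eq, EuclideanSpace.real_norm_sq_eq,
    Matrix.ofLp_toEuclideanCLM] at h2
  exact h2

lemma exists_unit_bilin_eq {M : Matrix m m ℝ} (hM : M ≠ 0) :
    ∃ φ ψ : m → ℝ, ∑ x, φ x ^ 2 = 1 ∧ ∑ x, ψ x ^ 2 = 1 ∧
      ∑ x, ∑ y, φ x * M x y * ψ y = specNorm M := by
  obtain ⟨v, h1, h2⟩ := exists_unit_mulVec hM
  have hpos := specNorm_pos hM
  refine ⟨fun x => M.mulVec v x / specNorm M, v, ?_, h1, ?_⟩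
  · simp only [div_pow]
    rw [← Finset.sum_div, h2]
    field_simp
  · have : ∀ x, ∑ y, M.mulVec v x / specNorm M * M x y * v y
        = (M.mulVec v x) ^ 2 / specNorm M := fun x => by
      rw [sq, mul_div_right_comm]
      nth_rw 3 [Matrix.mulVec]
      rw [dotProduct, Finset.mul_sum]
      exact Finset.sum_congr rfl fun y _ => by ring
    simp only [this]
    rw [← Finset.sum_div, h2]
    field_simp

/-- A nonzero symmetric matrix that vanishes inside the two classes of a bipartition has a
top eigenvector whose restrictions to both classes are unit vectors. -/
lemma exists_balanced_vector {M : Matrix m m ℝ} (hM : M ≠ 0) (hs : M.IsSymm) (F : m → Bool)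
    (hF : ∀ x y, F x = F y → M x y = 0) :
    ∃ δ : m → ℝ, (∀ a, ∑ x, (if F x = a then δ x ^ 2 else 0) = 1) ∧
      ∀ a b, a ≠ b → ∑ x, (if F x = a then
        δ x * ∑ y, (if F y = b then M x y * δ y else 0) else 0) = specNorm M := by
  obtain ⟨v, h1, h2⟩ := exists_unit_mulVec hM
  have hpos := specNorm_pos hM
  set c := specNorm M with hc
  let w : Bool → m → ℝ := fun a x => if F x = a then v x else 0
  have hwF : ∀ a x, F x = a → M.mulVec (w a) x = 0 := fun a x hx => by
    refine Finset.sum_eq_zero fun y _ => ?_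
    by_cases hy : F y = a
    · simp [hF x y (hx.trans hy.symm)]
    · simp [w, hy]
  have hv : v = w true + w false := by
    ext x; cases h : F x <;> simp [w, h]
  have hvs : ∑ x, v x ^ 2 = ∑ x, w true x ^ 2 + ∑ x, w false x ^ 2 := by
    rw [← Finset.sum_add_distrib]
    refine Finset.sum_congr rfl fun x _ => ?_
    cases h : F x <;> simp [w, h]
  have hMs : ∑ x, M.mulVec v x ^ 2
      = ∑ x, M.mulVec (w true) x ^ 2 + ∑ x, M.mulVec (w false) x ^ 2 := by
    rw [← Finset.sum_add_distrib]
    refine Finset.sum_congr rfl fun x _ => ?_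
    rw [hv, Matrix.mulVec_add, Pi.add_apply]
    cases h : F x
    · rw [hwF false x h]; ring
    · rw [hwF true x h]; ring
  have ht := sum_mulVec_sq_le M (w true)
  have hf := sum_mulVec_sq_le M (w false)
  have heq : ∀ a, ∑ x, M.mulVec (w a) x ^ 2 = c ^ 2 * ∑ x, w a x ^ 2 := by
    have h3 : c ^ 2 * (∑ x, w true x ^ 2 + ∑ x, w false x ^ 2) = c ^ 2 := by
      rw [← hvs, h1, mul_one]
    rintro (_ | _) <;> linarith
  obtain ⟨a, ha⟩ : ∃ a, 0 < ∑ x, w a x ^ 2 := by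
    by_contra! h
    linarith [h true, h false]
  set s := √(∑ x, w a x ^ 2) with hsdef
  have hs0 : 0 < s := Real.sqrt_pos.2 ha
  have hs2 : s ^ 2 = ∑ x, w a x ^ 2 := Real.sq_sqrt ha.le
  let δ : m → ℝ := fun x => if F x = a then v x / s else M.mulVec (w a) x / (c * s)
  have hMδ : ∀ x, ∑ y, (if F y = a then M x y * δ y else 0) = M.mulVec (w a) x / s := fun x => by
    rw [Matrix.mulVec, dotProduct, Finset.sum_div]
    refine Finset.sum_congr rfl fun y _ => ?_
    by_cases hy : F y = a <;> simp [δ, w, hy, mul_div_assoc]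
  have hne : ∀ b, b ≠ a → ∑ x, (if F x = b then
      δ x * ∑ y, (if F y = a then M x y * δ y else 0) else 0) = c := fun b hb => by
    have : ∀ x, (if F x = b then
        δ x * ∑ y, (if F y = a then M x y * δ y else 0) else 0)
        = M.mulVec (w a) x ^ 2 / (c * s ^ 2) := fun x => by
      rw [hMδ]
      by_cases hx : F x = a
      · rw [if_neg (fun h => hb (h.symm.trans hx)), hwF a x hx]; simp
      · have : F x = b := by
          revert hx hb; cases F x <;> cases a <;> cases b <;> simp
        rw [if_pos this]
        simp only [δ, if_neg hx]
        field_simp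
    simp only [this]
    rw [← Finset.sum_div, heq, ← hs2]
    field_simp
  refine ⟨δ, fun b => ?_, fun b b' hb => ?_⟩
  · by_cases hb : b = a
    · subst hb
      have : ∀ x, (if F x = b then δ x ^ 2 else 0) = w b x ^ 2 / s ^ 2 := fun x => by
        by_cases hx : F x = b <;> simp [δ, w, hx, div_pow]
      simp only [this]
      rw [← Finset.sum_div, hs2, div_self ha.ne']
    · have : ∀ x, (if F x = b then δ x ^ 2 else 0)
          = M.mulVec (w a) x ^ 2 / (c ^ 2 * s ^ 2) := fun x => by
        by_cases hx : F x = a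
        · rw [if_neg (fun h => hb (h.symm.trans hx)), hwF a x hx]; simp
        · have h' : F x = b := by
            revert hx hb; cases F x <;> cases a <;> cases b <;> simp
          rw [if_pos h']
          simp only [δ, if_neg hx]
          rw [div_pow, mul_pow]
      simp only [this]
      rw [← Finset.sum_div, heq, ← hs2]
      field_simp
  · by_cases hb' : b' = a
    · subst hb'; exact hne b hb
    · have hba : b = a := by
        revert hb hb'; cases a <;> cases b <;> cases b' <;> simp
      subst hba
      rw [← hne b' hb']
      simp only [Finset.mul_sum, ← Finset.sum_filter]
      rw [Finset.sum_comm]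
      exact Finset.sum_congr rfl fun x _ => Finset.sum_congr rfl fun y _ => by
        rw [hs.apply]; ring

end SpecNorm

section Compose
variable {A H J : Type} [Fintype A] [Fintype H] [Fintype J] [DecidableEq J]
  {C : J → Type} [∀ j, Fintype (C j)]

/-- The data of a composed index set: `t x` is the outer input and `c x` the tuple of inner
inputs of `x`, and `H` consists of all compatible pairs of these. -/
structure IsComposition (bit : A → J → Bool) (γ : ∀ j, C j → Bool) (t : H → A)
    (c : H → ∀ j, C j) : Prop where
  compat : ∀ x j, γ j (c x j) = bit (t x) j
  ext : ∀ x y, t x = t y → c x = c y → x = y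
  surj : ∀ a u, (∀ j, γ j (u j) = bit a j) → ∃ x, t x = a ∧ c x = u

/-- The composition of an outer matrix with a family of inner matrices. -/
def composeMatrix (t : H → A) (c : H → ∀ j, C j) (B : Matrix A A ℝ)
    (G : ∀ j, Matrix (C j) (C j) ℝ) : Matrix H H ℝ :=
  Matrix.of fun x y => B (t x) (t y) * ∏ j, G j (c x j) (c y j)

variable {bit : A → J → Bool} {γ : ∀ j, C j → Bool} {t : H → A} {c : H → ∀ j, C j}

lemma IsComposition.sum_eq (h : IsComposition bit γ t c) (P : A → ℝ) (q : ∀ j, C j → ℝ) :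
    ∑ x, P (t x) * ∏ j, q j (c x j)
      = ∑ a, P a * ∏ j, ∑ u, if γ j u = bit a j then q j u else 0 := by
  have : ∀ a, (∏ j, ∑ u, if γ j u = bit a j then q j u else 0)
      = ∑ u : ∀ j, C j, if ∀ j, γ j (u j) = bit a j then ∏ j, q j (u j) else 0 := fun a => by
    rw [Fintype.prod_sum]
    refine Finset.sum_congr rfl fun u _ => ?_
    rw [Finset.prod_ite_zero]
    simp
  simp only [this, Finset.mul_sum, mul_ite, mul_zero]
  rw [← Fintype.sum_prod_type', ← Finset.sum_filter]
  refine Finset.sum_bij (fun x _ => (t x, c x)) (fun x _ => ?_) (fun x _ y _ hxy => ?_)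
    (fun p hp => ?_) (fun x _ => rfl)
  · simpa using h.compat x
  · exact h.ext x y (Prod.ext_iff.1 hxy).1 (Prod.ext_iff.1 hxy).2
  · obtain ⟨x, hx1, hx2⟩ := h.surj p.1 p.2 (by simpa using hp)
    exact ⟨x, Finset.mem_univ _, Prod.ext hx1 hx2⟩

variable [DecidableEq A] [DecidableEq H]

lemma le_specNorm_composeMatrix (h : IsComposition bit γ t c) {B : Matrix A A ℝ} (hB : B ≠ 0)
    (G : ∀ j, Matrix (C j) (C j) ℝ) (κ : J → ℝ) (δ : ∀ j, C j → ℝ)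
    (hunit : ∀ j a, ∑ u, (if γ j u = a then δ j u ^ 2 else 0) = 1)
    (hform : ∀ j a b, ∑ u, (if γ j u = a then
      δ j u * ∑ v, (if γ j v = b then G j u v * δ j v else 0) else 0) = κ j) :
    specNorm B * ∏ j, κ j ≤ specNorm (composeMatrix t c B G) := by
  obtain ⟨φ, ψ, hφ, hψ, hφψ⟩ := exists_unit_bilin_eq hB
  have hnorm : ∀ χ : A → ℝ, ∑ x, (χ (t x) * ∏ j, δ j (c x j)) ^ 2 = ∑ a, χ a ^ 2 := fun χ => by
    simp only [mul_pow, ← Finset.prod_pow]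
    rw [h.sum_eq (fun a => χ a ^ 2) (fun j u => δ j u ^ 2)]
    simp [hunit]
  have key := bilin_le_specNorm (composeMatrix t c B G)
    (fun x => φ (t x) * ∏ j, δ j (c x j)) (fun y => ψ (t y) * ∏ j, δ j (c y j))
  rw [hnorm, hnorm, hφ, hψ] at key
  have e : ∑ x, ∑ y, (φ (t x) * ∏ j, δ j (c x j)) * composeMatrix t c B G x y *
      (ψ (t y) * ∏ j, δ j (c y j)) = specNorm B * ∏ j, κ j := by
    have h1 : ∀ x, ∑ y, (φ (t x) * ∏ j, δ j (c x j)) * composeMatrix t c B G x y *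
        (ψ (t y) * ∏ j, δ j (c y j))
        = ∑ b, (φ (t x) * B (t x) b * ψ b) * ∏ j, (δ j (c x j) *
          ∑ v, if γ j v = bit b j then G j (c x j) v * δ j v else 0) := fun x => by
      have h2 := h.sum_eq (fun b => B (t x) b * ψ b) (fun j v => G j (c x j) v * δ j v)
      calc _ = (φ (t x) * ∏ j, δ j (c x j)) *
            ∑ y, B (t x) (t y) * ψ (t y) * ∏ j, G j (c x j) (c y j) * δ j (c y j) := by
            rw [Finset.mul_sum]
            refine Finset.sum_congr rfl fun y _ => ?_
            rw [Finset.prod_mul_distrib]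
            simp only [composeMatrix, Matrix.of_apply]
            ring
        _ = _ := by
            rw [h2, Finset.mul_sum]
            refine Finset.sum_congr rfl fun b _ => ?_
            rw [Finset.prod_mul_distrib]
            ring
    simp only [h1]
    rw [Finset.sum_comm, ← hφψ, Finset.sum_comm (f := fun x y => φ x * B x y * ψ y),
      Finset.sum_mul]
    refine Finset.sum_congr rfl fun b _ => ?_
    rw [h.sum_eq (fun a => φ a * B a b * ψ b) (fun j u => δ j u *
          ∑ v, if γ j v = bit b j then G j u v * δ j v else 0)]
    simp only [hform]
    rw [Finset.sum_mul]
  rw [e] at key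
  linarith

variable [∀ j, DecidableEq (C j)]

lemma specNorm_composeMatrix_le (h : IsComposition bit γ t c) (B : Matrix A A ℝ)
    (G : ∀ j, Matrix (C j) (C j) ℝ) (κ : J → ℝ) (hκ : ∀ j, 0 ≤ κ j)
    (hG : ∀ j, (G j).PosSemidef)
    (hdiag : ∀ j u v, γ j u = γ j v → G j u v = if u = v then κ j else 0) :
    specNorm (composeMatrix t c B G) ≤ specNorm B * ∏ j, κ j := by
  have hgram : ∀ j, ∃ (m : ℕ) (r : Fin m → C j → ℝ), ∀ u v, G j u v = ∑ i, r i u * r i v := by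
    intro j
    obtain ⟨m, r, hr⟩ := Matrix.posSemidef_iff_eq_sum_vecMulVec.1 (hG j)
    refine ⟨m, r, fun u v => ?_⟩
    rw [hr, Matrix.sum_apply]
    simp [Matrix.vecMulVec_apply]
  choose m r hr using hgram
  let R : (∀ j, Fin (m j)) → H → ℝ := fun τ x => ∏ j, r j (τ j) (c x j)
  have hR : ∀ x y, ∏ j, G j (c x j) (c y j) = ∑ τ, R τ x * R τ y := fun x y => by
    simp only [hr, Fintype.prod_sum, R, Finset.prod_mul_distrib]
  let W : (H → ℝ) → (∀ j, Fin (m j)) → A → ℝ := fun φ τ a =>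
    ∑ x, if t x = a then φ x * R τ x else 0
  have hW : ∀ φ τ (k : A → ℝ), ∑ a, W φ τ a * k a = ∑ x, φ x * R τ x * k (t x) := by
    intro φ τ k
    simp only [W, Finset.sum_mul]
    rw [Finset.sum_comm]
    refine Finset.sum_congr rfl fun x _ => ?_
    simp
  have hfib : ∀ x y, t y = t x →
      ∑ τ, R τ x * R τ y = if y = x then ∏ j, κ j else 0 := by
    intro x y hxy
    have hd : ∀ j, G j (c x j) (c y j) = if c x j = c y j then κ j else 0 := fun j =>
      hdiag j _ _ (by rw [h.compat, h.compat, hxy])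
    rw [← hR]
    simp only [hd]
    by_cases hyx : y = x
    · simp [hyx]
    · rw [if_neg hyx]
      obtain ⟨j, hj⟩ : ∃ j, c x j ≠ c y j := by
        by_contra! hc
        exact hyx (h.ext _ _ hxy (funext fun j => (hc j).symm))
      exact Finset.prod_eq_zero (Finset.mem_univ j) (if_neg hj)
  have hnorm : ∀ φ, ∑ τ, ∑ a, W φ τ a ^ 2 = (∏ j, κ j) * ∑ x, φ x ^ 2 := by
    intro φ
    simp only [sq (W φ _ _), hW]
    rw [Finset.sum_comm, Finset.mul_sum]
    refine Finset.sum_congr rfl fun x _ => ?_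
    simp only [W, Finset.mul_sum]
    rw [Finset.sum_comm]
    rw [Finset.sum_eq_single x]
    · have := hfib x x rfl
      simp only [if_true] at this ⊢
      rw [← this, Finset.sum_mul]
      exact Finset.sum_congr rfl fun τ _ => by ring
    · intro y _ hyx
      by_cases hxy : t y = t x
      · have := hfib x y hxy
        rw [if_neg hyx] at this
        simp only [hxy, if_true]
        calc _ = φ x * φ y * ∑ τ, R τ x * R τ y := by
              rw [Finset.mul_sum]
              exact Finset.sum_congr rfl fun τ _ => by ring
          _ = 0 := by rw [this, mul_zero]
      · simp [hxy]
    · simp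
  refine specNorm_le_of_bilin_le _
    (mul_nonneg (specNorm_nonneg B) (Finset.prod_nonneg fun j _ => hκ j)) fun φ ψ => ?_
  have hform : ∑ x, ∑ y, φ x * composeMatrix t c B G x y * ψ y
      = ∑ τ, ∑ a, ∑ b, W φ τ a * B a b * W ψ τ b := by
    have h1 : ∀ τ, ∑ a, ∑ b, W φ τ a * B a b * W ψ τ b
        = ∑ x, ∑ y, φ x * R τ x * (ψ y * R τ y * B (t x) (t y)) := fun τ => by
      have : ∀ a, ∑ b, W φ τ a * B a b * W ψ τ b
          = W φ τ a * ∑ y, ψ y * R τ y * B a (t y) := fun a => by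
        rw [← hW, Finset.mul_sum]
        exact Finset.sum_congr rfl fun b _ => by ring
      simp only [this]
      rw [hW φ τ fun a => ∑ y, ψ y * R τ y * B a (t y)]
      simp only [Finset.mul_sum]
    simp only [h1]
    symm
    rw [Finset.sum_comm]
    refine Finset.sum_congr rfl fun x _ => ?_
    rw [Finset.sum_comm]
    refine Finset.sum_congr rfl fun y _ => ?_
    simp only [composeMatrix, Matrix.of_apply, hR, Finset.mul_sum, Finset.sum_mul]
    exact Finset.sum_congr rfl fun τ _ => by ring
  rw [hform]
  calc _ ≤ ∑ τ, specNorm B * ((∑ a, W φ τ a ^ 2 + ∑ b, W ψ τ b ^ 2) / 2) :=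
        Finset.sum_le_sum fun τ _ => bilin_le_specNorm B _ _
    _ = _ := by
        rw [← Finset.mul_sum, ← Finset.sum_div, Finset.sum_add_distrib, hnorm, hnorm]
        ring

end Compose

section Adversary
variable {ι : Type} [Fintype ι] {m : Type}

/-- The entrywise product of `M` with the 0/1 matrix of pairs that `b` tells apart. -/
def diffMatrix (b : m → Bool) (M : Matrix m m ℝ) : Matrix m m ℝ :=
  Matrix.of fun x y => if b x = b y then 0 else M x y

lemma diffMatrix_isSymm (b : m → Bool) {M : Matrix m m ℝ} (hM : M.IsSymm) :
    (diffMatrix b M).IsSymm := by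
  ext x y
  simp only [diffMatrix, Matrix.transpose_apply, Matrix.of_apply, hM.apply, eq_comm]

variable {D : Finset (ι → Bool)} {F : (ι → Bool) → Bool}
  {Γ : Matrix {u // u ∈ D} {u // u ∈ D} ℝ}

lemma specNorm_diffMatrix_le_iSup (i : ι) :
    specNorm (diffMatrix (fun x => x.1 i) Γ)
      ≤ ⨆ i : ι, specNorm (diffMatrix (fun x => x.1 i) Γ) := by
  have h : BddAbove (Set.range fun i : ι =>
      specNorm (diffMatrix (fun x : {u // u ∈ D} => x.1 i) Γ)) := (Set.finite_range _).bddAbove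
  exact le_ciSup h i

lemma abs_apply_le_iSup (hF : ∀ x y : {u // u ∈ D}, F x.1 = F y.1 → Γ x y = 0)
    (x y : {u // u ∈ D}) : |Γ x y| ≤ ⨆ i : ι, specNorm (diffMatrix (fun x => x.1 i) Γ) := by
  by_cases hxy : x = y
  · rw [hF x y (by rw [hxy]), abs_zero]
    exact Real.iSup_nonneg fun i => specNorm_nonneg _
  · obtain ⟨i, hi⟩ : ∃ i, x.1 i ≠ y.1 i := by
      by_contra! h
      exact hxy (Subtype.ext (funext h))
    have h1 := abs_apply_le_specNorm (diffMatrix (fun x : {u // u ∈ D} => x.1 i) Γ) x y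
    simp only [diffMatrix, Matrix.of_apply, if_neg hi] at h1
    exact h1.trans (specNorm_diffMatrix_le_iSup i)

lemma iSup_specNorm_diffMatrix_pos (hΓ : Γ ≠ 0)
    (hF : ∀ x y : {u // u ∈ D}, F x.1 = F y.1 → Γ x y = 0) :
    0 < ⨆ i : ι, specNorm (diffMatrix (fun x => x.1 i) Γ) := by
  by_contra! h
  refine hΓ (Matrix.ext fun x y => ?_)
  simpa using (abs_apply_le_iSup hF x y).trans h

variable [DecidableEq ι] [Fintype m] [DecidableEq m]

lemma adv_nonneg (D : Finset (ι → Bool)) (F : (ι → Bool) → Bool) : 0 ≤ adv D F := by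
  refine Real.sSup_nonneg ?_
  rintro r ⟨Γ, -, -, -, rfl⟩
  exact div_nonneg (specNorm_nonneg _) (Real.iSup_nonneg fun i => specNorm_nonneg _)

lemma le_adv {r : ℝ} (hΓ : Γ ≠ 0) (hs : Γ.IsSymm)
    (hF : ∀ x y : {u // u ∈ D}, F x.1 = F y.1 → Γ x y = 0) (hr : 0 ≤ r)
    (h : ∀ i, r * specNorm (diffMatrix (fun x => x.1 i) Γ) ≤ specNorm Γ) : r ≤ adv D F := by
  have hbdd : BddAbove { r : ℝ | ∃ Γ : Matrix {u // u ∈ D} {u // u ∈ D} ℝ, Γ ≠ 0 ∧ Γ.IsSymm ∧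
      (∀ x y : {u // u ∈ D}, F x.1 = F y.1 → Γ x y = 0) ∧
      r = specNorm Γ /
        ⨆ i : ι, specNorm (Matrix.of fun x y : {u // u ∈ D} =>
          if x.1 i = y.1 i then 0 else Γ x y) } := by
    refine ⟨Fintype.card {u // u ∈ D}, ?_⟩
    rintro _ ⟨Γ', hΓ', -, hF', rfl⟩
    have hpos := iSup_specNorm_diffMatrix_pos hΓ' hF'
    exact (div_le_iff₀ hpos).2 (specNorm_le_of_abs_apply_le Γ' hpos.le (abs_apply_le_iSup hF'))
  have hpos := iSup_specNorm_diffMatrix_pos hΓ hF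
  refine le_trans ?_ (le_csSup hbdd ⟨Γ, hΓ, hs, hF, rfl⟩)
  refine (le_div_iff₀ hpos).2 ?_
  change r * (⨆ i : ι, specNorm (diffMatrix (fun x => x.1 i) Γ)) ≤ _
  rw [Real.mul_iSup_of_nonneg hr]
  exact Real.iSup_le h (specNorm_nonneg _)

lemma exists_of_lt_adv {s : ℝ} (hs : 0 ≤ s) (h : s < adv D F) :
    ∃ Γ : Matrix {u // u ∈ D} {u // u ∈ D} ℝ, Γ ≠ 0 ∧ Γ.IsSymm ∧
      (∀ x y : {u // u ∈ D}, F x.1 = F y.1 → Γ x y = 0) ∧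
      ∀ i, s * specNorm (diffMatrix (fun x => x.1 i) Γ) ≤ specNorm Γ := by
  have hne : Set.Nonempty { r : ℝ | ∃ Γ : Matrix {u // u ∈ D} {u // u ∈ D} ℝ, Γ ≠ 0 ∧
      Γ.IsSymm ∧ (∀ x y : {u // u ∈ D}, F x.1 = F y.1 → Γ x y = 0) ∧
      r = specNorm Γ /
        ⨆ i : ι, specNorm (Matrix.of fun x y : {u // u ∈ D} =>
          if x.1 i = y.1 i then 0 else Γ x y) } := by
    by_contra hempty
    rw [Set.not_nonempty_iff_eq_empty] at hempty
    rw [adv, hempty, Real.sSup_empty] at h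
    linarith
  obtain ⟨_, ⟨Γ, hΓ, hsymm, hF, rfl⟩, hlt⟩ := exists_lt_of_lt_csSup hne h
  refine ⟨Γ, hΓ, hsymm, hF, fun i => ?_⟩
  have hpos := iSup_specNorm_diffMatrix_pos hΓ hF
  have h1 := (lt_div_iff₀ hpos).1 hlt
  exact (mul_le_mul_of_nonneg_left (specNorm_diffMatrix_le_iSup i) hs).trans h1.le

/-- Adding a multiple of the identity that dominates the spectral norm makes a symmetric
matrix positive semidefinite. -/
lemma posSemidef_add_smul_one {M : Matrix m m ℝ} (hM : M.IsSymm) :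
    (M + specNorm M • (1 : Matrix m m ℝ)).PosSemidef := by
  refine Matrix.PosSemidef.of_dotProduct_mulVec_nonneg ?_ fun v => ?_
  · rw [Matrix.IsHermitian, Matrix.conjTranspose_eq_transpose_of_trivial, Matrix.transpose_add,
      hM.eq]
    simp
  · have h := bilin_le_specNorm M (-v) v
    have e : star v ⬝ᵥ (M + specNorm M • (1 : Matrix m m ℝ)).mulVec v
        = specNorm M * ((∑ x, (-v) x ^ 2 + ∑ y, v y ^ 2) / 2)
          - ∑ x, ∑ y, (-v) x * M x y * v y := by
      rw [Matrix.add_mulVec, dotProduct_add, Matrix.smul_mulVec, Matrix.one_mulVec]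
      simp only [dotProduct, Matrix.mulVec, Pi.star_apply, star_trivial, Pi.neg_apply, neg_sq,
        Pi.smul_apply, smul_eq_mul, neg_mul, Finset.sum_neg_distrib, add_self_div_two,
        sub_neg_eq_add, Finset.mul_sum]
      rw [add_comm]
      congr 1
      · exact Finset.sum_congr rfl fun x _ => by ring
      · exact Finset.sum_congr rfl fun x _ => Finset.sum_congr rfl fun y _ => by ring
    rw [e]
    linarith

end Adversary

section ComposeAdversary
variable {n : ℕ} {k : Fin n → ℕ} {D : Finset (Fin n → Bool)}
  {C : ∀ j, Finset (Fin (k j) → Bool)} {g : ∀ j, (Fin (k j) → Bool) → Bool}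

variable (D C g) in
/-- The domain of the composed function. -/
abbrev composeDomain : Finset (((j : Fin n) × Fin (k j)) → Bool) :=
  Finset.univ.filter fun x : ((j : Fin n) × Fin (k j)) → Bool =>
    (∀ j, (fun q => x ⟨j, q⟩) ∈ C j) ∧ ((fun j => g j fun q => x ⟨j, q⟩) ∈ D)

/-- The outer input computed from an input of the composed function. -/
def outerInput (x : {u // u ∈ composeDomain D C g}) : {u // u ∈ D} :=
  ⟨fun j => g j fun q => x.1 ⟨j, q⟩, (Finset.mem_filter.1 x.2).2.2⟩

/-- The blocks of an input of the composed function. -/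
def innerInput (x : {u // u ∈ composeDomain D C g}) (j : Fin n) : {u // u ∈ C j} :=
  ⟨fun q => x.1 ⟨j, q⟩, (Finset.mem_filter.1 x.2).2.1 j⟩

lemma isComposition_composeDomain :
    IsComposition (fun (a : {u // u ∈ D}) j => a.1 j) (fun j (u : {u // u ∈ C j}) => g j u.1)
      (outerInput (D := D) (C := C) (g := g)) innerInput where
  compat _ _ := rfl
  ext x y _ h := by
    refine Subtype.ext (funext fun p => ?_)
    exact congrFun (congrArg Subtype.val (congrFun h p.1)) p.2
  surj a u h := by
    have ha : (fun j => g j (u j).1) = a.1 := funext h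
    refine ⟨⟨fun p => (u p.1).1 p.2, Finset.mem_filter.2
      ⟨Finset.mem_univ _, fun j => (u j).2, ?_⟩⟩, Subtype.ext ha, rfl⟩
    exact ha ▸ a.2

/-- For a suitable vector `δ`, the quadratic form of `M + ‖M‖ • 1` has the same value `‖M‖` on
every pair of classes of the bipartition. -/
lemma exists_balanced_vector_add_smul_one {m : Type} [Fintype m] [DecidableEq m]
    {M : Matrix m m ℝ} (hM : M ≠ 0) (hs : M.IsSymm) (F : m → Bool)
    (hF : ∀ x y, F x = F y → M x y = 0) :
    ∃ δ : m → ℝ, (∀ a, ∑ x, (if F x = a then δ x ^ 2 else 0) = 1) ∧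
      ∀ a b, ∑ x, (if F x = a then δ x * ∑ y, (if F y = b then
        (M + specNorm M • (1 : Matrix m m ℝ)) x y * δ y else 0) else 0) = specNorm M := by
  obtain ⟨δ, h1, h2⟩ := exists_balanced_vector hM hs F hF
  refine ⟨δ, h1, fun a b => ?_⟩
  by_cases hab : a = b
  · subst hab
    refine Eq.trans ?_ (mul_one (specNorm M))
    rw [← h1 a, Finset.mul_sum]
    refine Finset.sum_congr rfl fun x _ => ?_
    by_cases hx : F x = a
    · rw [if_pos hx, if_pos hx, Finset.sum_eq_single x]
      · simp [hx, hF x x rfl]; ring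
      · intro y _ hyx
        by_cases hy : F y = a
        · simp [hy, hF x y (hx.trans hy.symm), Matrix.one_apply_ne hyx.symm]
        · simp [hy]
      · simp
    · simp [hx]
  · rw [← h2 a b hab]
    refine Finset.sum_congr rfl fun x _ => ?_
    by_cases hx : F x = a
    · rw [if_pos hx, if_pos hx]
      congr 1
      refine Finset.sum_congr rfl fun y _ => ?_
      by_cases hy : F y = b
      · have : x ≠ y := by rintro rfl; exact hab (hx.symm.trans hy)
        simp [hy, Matrix.one_apply_ne this]
      · simp [hy]
    · simp [hx]

lemma add_smul_one_apply_of_eq {m : Type} [DecidableEq m] {M : Matrix m m ℝ} {F : m → Bool}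
    (hF : ∀ x y, F x = F y → M x y = 0) (r : ℝ) (x y : m) (h : F x = F y) :
    (M + r • (1 : Matrix m m ℝ)) x y = if x = y then r else 0 := by
  simp [hF x y h, Matrix.one_apply]

lemma mul_le_adv_compose {f : (Fin n → Bool) → Bool} {s t : ℝ} (hs : 0 ≤ s) (ht : 0 ≤ t)
    (hsf : s < adv D f) (htg : ∀ j, t < adv (C j) (g j)) :
    s * t ≤ adv (composeDomain D C g) (fun x => f fun j => g j fun q => x ⟨j, q⟩) := by
  obtain ⟨B, hB0, hBs, hBf, hBle⟩ := exists_of_lt_adv hs hsf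
  choose M hM0 hMs hMg hMle using fun j => exists_of_lt_adv ht (htg j)
  have hcomp := isComposition_composeDomain (D := D) (C := C) (g := g)
  let G : ∀ j, Matrix {u // u ∈ C j} {u // u ∈ C j} ℝ := fun j => M j + specNorm (M j) • 1
  let Γ := composeMatrix (outerInput (D := D) (C := C) (g := g)) innerInput B G
  have hMpos : ∀ j, 0 < specNorm (M j) := fun j => specNorm_pos (hM0 j)
  have hlow : specNorm B * ∏ j, specNorm (M j) ≤ specNorm Γ := by
    choose δ hδ1 hδ2 using fun j =>
      exists_balanced_vector_add_smul_one (hM0 j) (hMs j) (fun u => g j u.1) (hMg j)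
    exact le_specNorm_composeMatrix hcomp hB0 G (fun j => specNorm (M j)) δ hδ1 hδ2
  have hGs : ∀ j, (G j).IsSymm := fun j => by
    refine (hMs j).add ?_
    rw [Matrix.IsSymm, Matrix.transpose_smul, Matrix.transpose_one]
  refine le_adv (Γ := Γ) ?_ ?_ ?_ (mul_nonneg hs ht) ?_
  · intro h0
    have : specNorm Γ = 0 := by rw [h0, specNorm, map_zero, norm_zero]
    have hpos := mul_pos (specNorm_pos hB0) (Finset.prod_pos (s := Finset.univ) fun j _ => hMpos j)
    linarith
  · ext x y
    simp only [Γ, composeMatrix, Matrix.transpose_apply, Matrix.of_apply, hBs.apply,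
      fun j => (hGs j).apply]
  · intro x y hxy
    have : B (outerInput x) (outerInput y) = 0 := hBf _ _ hxy
    simp [Γ, composeMatrix, this]
  · rintro ⟨p, q⟩
    let Q := diffMatrix (fun u : {u // u ∈ C p} => u.1 q) (M p)
    have hQg : ∀ u v : {u // u ∈ C p}, g p u.1 = g p v.1 → Q u v = 0 := fun u v huv => by
      simp [Q, diffMatrix, hMg p u v huv]
    let G' := Function.update G p (Q + specNorm Q • 1)
    let κ := Function.update (fun j => specNorm (M j)) p (specNorm Q)
    have hΓ : diffMatrix (fun x => x.1 ⟨p, q⟩) Γ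
        = composeMatrix (outerInput (D := D) (C := C) (g := g)) innerInput
          (diffMatrix (fun a => a.1 p) B) G' := by
      ext x y
      simp only [diffMatrix, Γ, composeMatrix, Matrix.of_apply]
      by_cases ho : (outerInput x).1 p = (outerInput y).1 p
      · rw [if_pos ho, zero_mul]
        by_cases hx : x.1 ⟨p, q⟩ = y.1 ⟨p, q⟩
        · rw [if_pos hx]
        · rw [if_neg hx]
          have hne : innerInput x p ≠ innerInput y p := fun h =>
            hx (congrFun (congrArg Subtype.val h) q)
          have : G p (innerInput x p) (innerInput y p) = 0 := by
            exact (add_smul_one_apply_of_eq (F := fun u : {u // u ∈ C p} => g p u.1)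
              (hMg p) _ (innerInput x p) (innerInput y p) ho).trans (if_neg hne)
          rw [Finset.prod_eq_zero (Finset.mem_univ p) this, mul_zero]
      · rw [if_neg ho]
        have hne : innerInput x p ≠ innerInput y p := fun h =>
          ho (congrArg (fun u : {u // u ∈ C p} => g p u.1) h)
        have hp : G' p (innerInput x p) (innerInput y p)
            = if x.1 ⟨p, q⟩ = y.1 ⟨p, q⟩ then 0 else G p (innerInput x p) (innerInput y p) := by
          simp only [G', G, Function.update_self, Matrix.add_apply, Matrix.smul_apply,
            Matrix.one_apply_ne hne, smul_zero, add_zero]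
          rfl
        rw [← Finset.mul_prod_erase _ _ (Finset.mem_univ p),
          ← Finset.mul_prod_erase _ (fun j => G' j (innerInput x j) (innerInput y j))
            (Finset.mem_univ p), hp,
          Finset.prod_congr (f := fun j => G' j (innerInput x j) (innerInput y j))
            (g := fun j => G j (innerInput x j) (innerInput y j)) rfl
            fun j hj => by simp only [G', Function.update_of_ne (Finset.ne_of_mem_erase hj)]]
        split_ifs <;> simp
    have hup : specNorm (diffMatrix (fun x => x.1 ⟨p, q⟩) Γ)
        ≤ specNorm (diffMatrix (fun a : {u // u ∈ D} => a.1 p) B) * ∏ j, κ j := by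
      rw [hΓ]
      refine specNorm_composeMatrix_le hcomp _ G' κ (fun j => ?_) (fun j => ?_) (fun j => ?_)
      · by_cases hj : j = p
        · subst hj; simpa [κ] using specNorm_nonneg Q
        · simpa [κ, hj] using specNorm_nonneg (M j)
      · by_cases hj : j = p
        · subst hj
          simpa [G'] using posSemidef_add_smul_one (diffMatrix_isSymm _ (hMs j))
        · simpa [G', hj] using posSemidef_add_smul_one (hMs j)
      · by_cases hj : j = p
        · subst hj
          simpa only [G', κ, Function.update_self] using
            add_smul_one_apply_of_eq (F := fun u : {u // u ∈ C j} => g j u.1) hQg (specNorm Q)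
        · simpa only [G', κ, Function.update_of_ne hj] using
            add_smul_one_apply_of_eq (F := fun u : {u // u ∈ C j} => g j u.1) (hMg j)
              (specNorm (M j))
    have hκ : ∏ j, κ j = specNorm Q * ∏ j ∈ Finset.univ.erase p, specNorm (M j) := by
      rw [← Finset.mul_prod_erase _ _ (Finset.mem_univ p)]
      congr 1
      · simp [κ]
      · exact Finset.prod_congr rfl fun j hj => by simp [κ, Finset.ne_of_mem_erase hj]
    have hrest : 0 ≤ ∏ j ∈ Finset.univ.erase p, specNorm (M j) :=
      Finset.prod_nonneg fun j _ => (hMpos j).le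
    calc _ ≤ s * t * (specNorm (diffMatrix (fun a : {u // u ∈ D} => a.1 p) B) *
          (specNorm Q * ∏ j ∈ Finset.univ.erase p, specNorm (M j))) :=
          mul_le_mul_of_nonneg_left (hκ ▸ hup) (mul_nonneg hs ht)
      _ = s * specNorm (diffMatrix (fun a : {u // u ∈ D} => a.1 p) B) *
          (t * specNorm Q) * ∏ j ∈ Finset.univ.erase p, specNorm (M j) := by ring
      _ ≤ specNorm B * specNorm (M p) * ∏ j ∈ Finset.univ.erase p, specNorm (M j) := by
          refine mul_le_mul_of_nonneg_right ?_ hrest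
          exact mul_le_mul (hBle p) (hMle p q) (mul_nonneg ht (specNorm_nonneg _))
            (specNorm_nonneg _)
      _ = specNorm B * ∏ j, specNorm (M j) := by
          rw [← Finset.mul_prod_erase _ _ (Finset.mem_univ p), mul_assoc]
      _ ≤ specNorm Γ := hlow

end ComposeAdversary

/-- Composition lower bound for the general adversary bound of partial Boolean
functions: Adv(f ∘ (g₁,…,g_n)) ≥ Adv(f) · min_j Adv(g_j). The composed function is
defined on bit positions indexed by Σ j, Fin (k j) (position q in block j), with
domain ℋ = {x : x^j ∈ C_j for all j, and x̃ = (g₁(x¹),…,g_n(xⁿ)) ∈ D}. -/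
theorem stmt_19 (n : ℕ) (hn : 1 ≤ n) (k : Fin n → ℕ)
    (D : Finset (Fin n → Bool)) (hD : D.Nonempty)
    (f : (Fin n → Bool) → Bool)
    (hf : ∃ u ∈ D, ∃ v ∈ D, f u ≠ f v)
    (C : ∀ j, Finset (Fin (k j) → Bool)) (hC : ∀ j, (C j).Nonempty)
    (g : ∀ j, (Fin (k j) → Bool) → Bool)
    (hg : ∀ j, ∃ u ∈ C j, ∃ v ∈ C j, g j u ≠ g j v) :
    adv D f * ⨅ j : Fin n, adv (C j) (g j) ≤
      adv
        (Finset.univ.filter fun x : ((j : Fin n) × Fin (k j)) → Bool =>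
          (∀ j, (fun q => x ⟨j, q⟩) ∈ C j) ∧ ((fun j => g j fun q => x ⟨j, q⟩) ∈ D))
        (fun x => f fun j => g j fun q => x ⟨j, q⟩) := by
  refine mul_le_of_forall_lt_of_nonneg (adv_nonneg D f) (adv_nonneg _ _)
    fun s hs0 hs t ht0 ht => mul_le_adv_compose hs0 ht0 hs fun j => ?_
  exact ht.trans_le (ciInf_le (Set.finite_range _).bddBelow j)
end
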